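/- NRC Parameter Collection: let L, R be sets of typed variables with C = L ∩ R, let φ_L and λ(z) be Δ0 formulas over L, let φ_R and ρ(z,y) be Δ0 formulas over R, let r be a variable of R and c a variable (of set type) of C. If φ_L ∧ φ_R entails ∃y ∈_p r ∀z ∈ c (λ(z) ↔ ρ(z,y)), then there exists an NRC expression E with free variables in C such that φ_L ∧ φ_R entails {z ∈ c : λ(z)} ∈ E. -/

import Mathlib

inductive NTy : Type
  | ur : NTy
  | unit : NTy
  | prod : NTy → NTy → NTy
  | set : NTy → NTy
deriving DecidableEq

def NObj (U : Type) : NTy → Type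
  | .ur => U
  | .unit => Unit
  | .prod a b => NObj U a × NObj U b
  | .set a => Set (NObj U a)

def NObj.asSet {U : Type} {T : NTy} (s : NObj U (NTy.set T)) : Set (NObj U T) := s

def Env (U : Type) (Γ : List NTy) : Type := (i : Fin Γ.length) → NObj U (Γ.get i)

def Env.nil {U : Type} : Env U [] := fun i => i.elim0

def Env.cons {U : Type} {T : NTy} {Γ : List NTy} (x : NObj U T) (ρ : Env U Γ) :
    Env U (T :: Γ) := fun i =>
  Fin.cases (motive := fun i => NObj U ((T :: Γ).get i)) x (fun j => ρ j) i

inductive Tm : List NTy → NTy → Type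
  | var {Γ} (i : Fin Γ.length) : Tm Γ (Γ.get i)
  | unit {Γ} : Tm Γ NTy.unit
  | pair {Γ a b} : Tm Γ a → Tm Γ b → Tm Γ (NTy.prod a b)
  | fst {Γ a b} : Tm Γ (NTy.prod a b) → Tm Γ a
  | snd {Γ a b} : Tm Γ (NTy.prod a b) → Tm Γ b

def Tm.eval {U : Type} : ∀ {Γ T}, Tm Γ T → Env U Γ → NObj U T
  | _, _, .var i, ρ => ρ i
  | _, _, .unit, _ => ()
  | _, _, .pair s t, ρ => (s.eval ρ, t.eval ρ)
  | _, _, .fst t, ρ => (t.eval ρ).1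
  | _, _, .snd t, ρ => (t.eval ρ).2

inductive D0 : List NTy → Type
  | eq {Γ} : Tm Γ NTy.ur → Tm Γ NTy.ur → D0 Γ
  | ne {Γ} : Tm Γ NTy.ur → Tm Γ NTy.ur → D0 Γ
  | tru {Γ} : D0 Γ
  | fls {Γ} : D0 Γ
  | and {Γ} : D0 Γ → D0 Γ → D0 Γ
  | or {Γ} : D0 Γ → D0 Γ → D0 Γ
  | all {Γ T} : Tm Γ (NTy.set T) → D0 (T :: Γ) → D0 Γ
  | ex {Γ T} : Tm Γ (NTy.set T) → D0 (T :: Γ) → D0 Γ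

def D0.Sat {U : Type} : ∀ {Γ}, D0 Γ → Env U Γ → Prop
  | _, .eq s t, ρ => s.eval ρ = t.eval ρ
  | _, .ne s t, ρ => s.eval ρ ≠ t.eval ρ
  | _, .tru, _ => True
  | _, .fls, _ => False
  | _, .and φ ψ, ρ => φ.Sat ρ ∧ ψ.Sat ρ
  | _, .or φ ψ, ρ => φ.Sat ρ ∨ ψ.Sat ρ
  | _, .all t φ, ρ => ∀ x ∈ NObj.asSet (t.eval ρ), φ.Sat (Env.cons x ρ)
  | _, .ex t φ, ρ => ∃ x ∈ NObj.asSet (t.eval ρ), φ.Sat (Env.cons x ρ)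

def Tm.fv : ∀ {Γ T}, Tm Γ T → Finset (Fin Γ.length)
  | _, _, .var i => {i}
  | _, _, .unit => ∅
  | _, _, .pair s t => s.fv ∪ t.fv
  | _, _, .fst t => t.fv
  | _, _, .snd t => t.fv

def lowerFv {n : ℕ} (s : Finset (Fin (n + 1))) : Finset (Fin n) :=
  Finset.univ.filter (fun j => j.succ ∈ s)

def D0.fv : ∀ {Γ}, D0 Γ → Finset (Fin Γ.length)
  | _, .eq s t => s.fv ∪ t.fv
  | _, .ne s t => s.fv ∪ t.fv
  | _, .tru => ∅
  | _, .fls => ∅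
  | _, .and φ ψ => φ.fv ∪ ψ.fv
  | _, .or φ ψ => φ.fv ∪ ψ.fv
  | _, .all t φ => t.fv ∪ lowerFv φ.fv
  | _, .ex t φ => t.fv ∪ lowerFv φ.fv

open Classical

/-- The default object of each type (used by `get` on non-singletons). -/
def NObj.defaultObj (U : Type) [Inhabited U] : ∀ T : NTy, NObj U T
  | .ur => (default : U)
  | .unit => ()
  | .prod a b => (NObj.defaultObj U a, NObj.defaultObj U b)
  | .set _ => (∅ : Set _)

/-- The nested relational calculus `NRC`, with tuple operations, singleton, empty set,
union, difference, the comprehension/union operator `⋃{E₁ | x ∈ E₂}`, and the `get`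
operator extracting the unique element of a singleton. -/
inductive NRC : List NTy → NTy → Type
  | var {Γ} (i : Fin Γ.length) : NRC Γ (Γ.get i)
  | unit {Γ} : NRC Γ NTy.unit
  | pair {Γ a b} : NRC Γ a → NRC Γ b → NRC Γ (NTy.prod a b)
  | fst {Γ a b} : NRC Γ (NTy.prod a b) → NRC Γ a
  | snd {Γ a b} : NRC Γ (NTy.prod a b) → NRC Γ b
  | sing {Γ T} : NRC Γ T → NRC Γ (NTy.set T)
  | empty {Γ T} : NRC Γ (NTy.set T)
  | union {Γ T} : NRC Γ (NTy.set T) → NRC Γ (NTy.set T) → NRC Γ (NTy.set T)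
  | diff {Γ T} : NRC Γ (NTy.set T) → NRC Γ (NTy.set T) → NRC Γ (NTy.set T)
  | bigUnion {Γ S T} : NRC (S :: Γ) (NTy.set T) → NRC Γ (NTy.set S) → NRC Γ (NTy.set T)
  | get {Γ T} : NRC Γ (NTy.set T) → NRC Γ T

/-- Evaluation of `NRC` expressions on nested relational instances. -/
noncomputable def NRC.eval {U : Type} [Inhabited U] : ∀ {Γ T}, NRC Γ T → Env U Γ → NObj U T
  | _, _, .var i, ρ => ρ i
  | _, _, .unit, _ => ()
  | _, _, .pair s t, ρ => (s.eval ρ, t.eval ρ)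
  | _, _, .fst t, ρ => (t.eval ρ).1
  | _, _, .snd t, ρ => (t.eval ρ).2
  | _, _, .sing e, ρ => ({e.eval ρ} : Set _)
  | _, _, .empty, _ => (∅ : Set _)
  | _, _, .union e₁ e₂, ρ => (NObj.asSet (e₁.eval ρ) ∪ NObj.asSet (e₂.eval ρ) : Set _)
  | _, _, .diff e₁ e₂, ρ => (NObj.asSet (e₁.eval ρ) \ NObj.asSet (e₂.eval ρ) : Set _)
  | _, _, .bigUnion e₁ e₂, ρ =>
      { y | ∃ x ∈ NObj.asSet (e₂.eval ρ), y ∈ NObj.asSet (e₁.eval (Env.cons x ρ)) }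
  | _, _, .get (T := T) e, ρ =>
      if h : ∃ x, e.eval ρ = ({x} : Set (NObj U T)) then h.choose else NObj.defaultObj U T

/-- Free variables of an `NRC` expression. -/
def NRC.fv : ∀ {Γ T}, NRC Γ T → Finset (Fin Γ.length)
  | _, _, .var i => {i}
  | _, _, .unit => ∅
  | _, _, .pair s t => s.fv ∪ t.fv
  | _, _, .fst t => t.fv
  | _, _, .snd t => t.fv
  | _, _, .sing e => e.fv
  | _, _, .empty => ∅
  | _, _, .union e₁ e₂ => e₁.fv ∪ e₂.fv
  | _, _, .diff e₁ e₂ => e₁.fv ∪ e₂.fv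
  | _, _, .bigUnion e₁ e₂ => lowerFv e₁.fv ∪ e₂.fv
  | _, _, .get e => e.fv

/-- A *subtype occurrence*: a path from a type `T` down to a subtype `S`, descending
through set memberships and product projections. -/
inductive SubPath : NTy → NTy → Type
  | refl {T} : SubPath T T
  | mem {T S} (p : SubPath T S) : SubPath (NTy.set T) S
  | left {T₁ T₂ S} (p : SubPath T₁ S) : SubPath (NTy.prod T₁ T₂) S
  | right {T₁ T₂ S} (p : SubPath T₂ S) : SubPath (NTy.prod T₁ T₂) S

/-- The subobjects of `o` reachable along the subtype occurrence `p`; bounded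
quantification `∃ x ∈_p o` ranges over `Reach p o`. -/
def Reach {U : Type} : ∀ {T S : NTy}, SubPath T S → NObj U T → Set (NObj U S)
  | _, _, .refl, o => {o}
  | _, _, .mem p, o => { y | ∃ x ∈ NObj.asSet o, y ∈ Reach p x }
  | _, _, .left p, o => Reach p o.1
  | _, _, .right p, o => Reach p o.2

def castObj {U : Type} {T T' : NTy} (h : T = T') (x : NObj U T) : NObj U T' := h ▸ x

/-- `NRC` expressions not using the `get` operator (plain `NRC`). -/
def NRC.NoGet : ∀ {Γ T}, NRC Γ T → Prop
  | _, _, .var _ => True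
  | _, _, .unit => True
  | _, _, .pair s t => s.NoGet ∧ t.NoGet
  | _, _, .fst t => t.NoGet
  | _, _, .snd t => t.NoGet
  | _, _, .sing e => e.NoGet
  | _, _, .empty => True
  | _, _, .union e₁ e₂ => e₁.NoGet ∧ e₂.NoGet
  | _, _, .diff e₁ e₂ => e₁.NoGet ∧ e₂.NoGet
  | _, _, .bigUnion e₁ e₂ => e₁.NoGet ∧ e₂.NoGet
  | _, _, .get _ => False


/-! ### Countability of expressions -/

def NTy.enc : NTy → ℕ
  | .ur => Nat.pair 0 0
  | .unit => Nat.pair 1 0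
  | .prod a b => Nat.pair 2 (Nat.pair a.enc b.enc)
  | .set a => Nat.pair 3 a.enc

theorem NTy.enc_inj : ∀ a b : NTy, a.enc = b.enc → a = b := by
  intro a
  induction a with
  | ur => intro b h; cases b <;> simp [NTy.enc, Nat.pair_eq_pair] at h ⊢
  | unit => intro b h; cases b <;> simp [NTy.enc, Nat.pair_eq_pair] at h ⊢
  | prod a₁ a₂ ih₁ ih₂ =>
    intro b h
    cases b <;> simp [NTy.enc, Nat.pair_eq_pair] at h ⊢
    exact ⟨ih₁ _ h.1, ih₂ _ h.2⟩
  | set a ih =>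
    intro b h
    cases b <;> simp [NTy.enc, Nat.pair_eq_pair] at h ⊢
    exact ih _ h

instance NTy.instCountable : Countable NTy :=
  Function.Injective.countable (f := NTy.enc) (fun a b h => NTy.enc_inj a b h)

def Tm.enc : ∀ {Γ T}, Tm Γ T → ℕ
  | _, _, .var i => Nat.pair 0 i
  | _, _, .unit => Nat.pair 1 0
  | _, _, .pair s t => Nat.pair 2 (Nat.pair s.enc t.enc)
  | _, _, .fst t => Nat.pair 3 t.enc
  | _, _, .snd t => Nat.pair 4 t.enc

theorem Tm.enc_inj {Γ : List NTy} {T : NTy} (s : Tm Γ T) :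
    ∀ {T'} (t : Tm Γ T'), s.enc = t.enc → (⟨T, s⟩ : Σ T, Tm Γ T) = ⟨T', t⟩ := by
  induction s with
  | var i =>
    intro T' t h
    cases t <;> simp [Tm.enc, Nat.pair_eq_pair] at h
    have := Fin.ext h
    subst this; rfl
  | unit => intro T' t h; cases t <;> simp [Tm.enc, Nat.pair_eq_pair] at h ⊢
  | pair s₁ s₂ ih₁ ih₂ =>
    intro T' t h
    cases t <;> simp [Tm.enc, Nat.pair_eq_pair] at h
    have h1 := ih₁ _ h.1
    have h2 := ih₂ _ h.2
    cases h1; cases h2; rfl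
  | fst s ih =>
    intro T' t h
    cases t <;> simp [Tm.enc, Nat.pair_eq_pair] at h
    have h1 := ih _ h
    cases h1; rfl
  | snd s ih =>
    intro T' t h
    cases t <;> simp [Tm.enc, Nat.pair_eq_pair] at h
    have h1 := ih _ h
    cases h1; rfl

def D0.enc : ∀ {Γ}, D0 Γ → ℕ
  | _, .eq s t => Nat.pair 0 (Nat.pair s.enc t.enc)
  | _, .ne s t => Nat.pair 1 (Nat.pair s.enc t.enc)
  | _, .tru => Nat.pair 2 0
  | _, .fls => Nat.pair 3 0
  | _, .and s t => Nat.pair 4 (Nat.pair s.enc t.enc)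
  | _, .or s t => Nat.pair 5 (Nat.pair s.enc t.enc)
  | _, .all s t => Nat.pair 6 (Nat.pair s.enc t.enc)
  | _, .ex s t => Nat.pair 7 (Nat.pair s.enc t.enc)

theorem D0.enc_inj {Γ : List NTy} (s : D0 Γ) :
    ∀ (t : D0 Γ), s.enc = t.enc → s = t := by
  induction s with
  | tru => intro t h; cases t <;> simp [D0.enc, Nat.pair_eq_pair] at h ⊢
  | fls => intro t h; cases t <;> simp [D0.enc, Nat.pair_eq_pair] at h ⊢
  | eq a b | ne a b =>
    intro t h
    cases t <;> simp [D0.enc, Nat.pair_eq_pair] at h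
    have h1 := Tm.enc_inj _ _ h.1
    have h2 := Tm.enc_inj _ _ h.2
    cases h1; cases h2; rfl
  | and a b ih₁ ih₂ | or a b ih₁ ih₂ =>
    intro t h
    cases t <;> simp [D0.enc, Nat.pair_eq_pair] at h
    have h1 := ih₁ _ h.1
    have h2 := ih₂ _ h.2
    cases h1; cases h2; rfl
  | all a b ih | ex a b ih =>
    intro t h
    cases t <;> simp [D0.enc, Nat.pair_eq_pair] at h
    have h1 := Tm.enc_inj _ _ h.1
    cases h1
    have h2 := ih _ h.2
    cases h2; rfl

instance D0.instCountable {Γ : List NTy} : Countable (D0 Γ) :=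
  Function.Injective.countable (f := D0.enc) (fun a b h => D0.enc_inj a b h)

/-! ### Names, neutral terms, symbolic values -/

/-- Colours of names: common, left-private, right-private. -/
inductive Col : Type
  | c : Col
  | l : Col
  | r : Col

def Col.enc : Col → ℕ
  | .c => 0
  | .l => 1
  | .r => 2

instance Col.instCountable : Countable Col :=
  Function.Injective.countable (f := Col.enc) (fun a b h => by
    cases a <;> cases b <;> simp [Col.enc] at h ⊢)

abbrev Nm := Col × ℕ
abbrev Key := Nm × NTy

/-- Neutral terms: projections applied to a name. -/
inductive Neu : NTy → Type
  | var {T} (x : Nm) : Neu T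
  | fst {a b} : Neu (NTy.prod a b) → Neu a
  | snd {a b} : Neu (NTy.prod a b) → Neu b

def Neu.key : ∀ {T}, Neu T → Key
  | T, .var x => (x, T)
  | _, .fst n => n.key
  | _, .snd n => n.key

noncomputable def Nm.enc (x : Nm) : ℕ := Nat.pair x.1.enc x.2

theorem Nm.enc_inj (x y : Nm) (h : Nm.enc x = Nm.enc y) : x = y := by
  obtain ⟨a, n⟩ := x
  obtain ⟨b, m⟩ := y
  simp only [Nm.enc, Nat.pair_eq_pair] at h
  obtain ⟨h1, h2⟩ := h
  subst h2
  cases a <;> cases b <;> simp [Col.enc] at h1 ⊢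

noncomputable def Neu.enc : ∀ {T}, Neu T → ℕ
  | T, .var x => Nat.pair 0 (Nat.pair (Nm.enc x) T.enc)
  | _, .fst t => Nat.pair 3 t.enc
  | _, .snd t => Nat.pair 4 t.enc

theorem Neu.enc_inj {T : NTy} (s : Neu T) :
    ∀ {T'} (t : Neu T'), s.enc = t.enc → (⟨T, s⟩ : Σ T, Neu T) = ⟨T', t⟩ := by
  induction s with
  | var i =>
    intro T' t h
    cases t <;> simp [Neu.enc, Nat.pair_eq_pair] at h
    have h1 := Nm.enc_inj _ _ h.1
    have h2 := NTy.enc_inj _ _ h.2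
    subst h1; subst h2; rfl
  | fst s ih =>
    intro T' t h
    cases t <;> simp [Neu.enc, Nat.pair_eq_pair] at h
    have h1 := ih _ h
    cases h1; rfl
  | snd s ih =>
    intro T' t h
    cases t <;> simp [Neu.enc, Nat.pair_eq_pair] at h
    have h1 := ih _ h
    cases h1; rfl

instance Neu.instCountable {T : NTy} : Countable (Neu T) :=
  Function.Injective.countable (f := Neu.enc) (fun a b h => by
    have := Neu.enc_inj a b h
    cases this; rfl)

/-- Symbolic values. -/
def SV : NTy → Type
  | .ur => Neu .ur
  | .unit => Unit
  | .prod a b => SV a × SV b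
  | .set a => Neu (.set a)

theorem SV.countable : ∀ T, Countable (SV T)
  | .ur => inferInstanceAs (Countable (Neu .ur))
  | .unit => inferInstanceAs (Countable Unit)
  | .prod a b => by
    have := SV.countable a
    have := SV.countable b
    exact inferInstanceAs (Countable (SV a × SV b))
  | .set a => inferInstanceAs (Countable (Neu (.set a)))

instance SV.instCountable {T : NTy} : Countable (SV T) := SV.countable T

def reflect : ∀ T, Neu T → SV T
  | .ur, n => n
  | .unit, _ => ()
  | .prod a b, n => (reflect a (.fst n), reflect b (.snd n))
  | .set _, n => n

def SV.All (P : Key → Prop) : ∀ T, SV T → Prop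
  | .ur, n => P (Neu.key (T := .ur) n)
  | .unit, _ => True
  | .prod a b, s => SV.All P a s.1 ∧ SV.All P b s.2
  | .set a, n => P (Neu.key (T := .set a) n)

theorem SV.All.mono {P Q : Key → Prop} (h : ∀ k, P k → Q k) :
    ∀ (T : NTy) (s : SV T), SV.All P T s → SV.All Q T s
  | .ur, _, hs => h _ hs
  | .unit, _, _ => trivial
  | .prod a b, s, hs => ⟨SV.All.mono h a s.1 hs.1, SV.All.mono h b s.2 hs.2⟩
  | .set _, _, hs => h _ hs

theorem SV.all_reflect {P : Key → Prop} :
    ∀ (T : NTy) (n : Neu T), P n.key → SV.All P T (reflect T n)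
  | .ur, _, hs => hs
  | .unit, _, _ => trivial
  | .prod a b, n, hs => ⟨SV.all_reflect a (.fst n) hs, SV.all_reflect b (.snd n) hs⟩
  | .set _, _, hs => hs

def SEnv (Γ : List NTy) : Type := (i : Fin Γ.length) → SV (Γ.get i)

instance SEnv.instCountable {Γ : List NTy} : Countable (SEnv Γ) :=
  inferInstanceAs (Countable ((i : Fin Γ.length) → SV (Γ.get i)))

def SEnv.cons {T : NTy} {Γ : List NTy} (x : SV T) (ρ : SEnv Γ) :
    SEnv (T :: Γ) := fun i =>
  Fin.cases (motive := fun i => SV ((T :: Γ).get i)) x (fun j => ρ j) i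

def SEnv.All (P : Key → Prop) {Γ : List NTy} (e : SEnv Γ) : Prop := ∀ i, SV.All P _ (e i)

theorem SEnv.All.mono {P Q : Key → Prop} (h : ∀ k, P k → Q k) {Γ : List NTy} {e : SEnv Γ}
    (he : e.All P) : e.All Q := fun i => SV.All.mono h _ _ (he i)

theorem SEnv.all_cons {P : Key → Prop} {T : NTy} {Γ : List NTy} {x : SV T} {e : SEnv Γ}
    (hx : SV.All P T x) (he : e.All P) : (SEnv.cons x e).All P := by
  intro i
  refine Fin.cases (motive := fun i => SV.All P ((T :: Γ).get i) (SEnv.cons x e i)) ?_ ?_ i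
  · exact hx
  · intro j; exact he j

def Tm.seval : ∀ {Γ T}, Tm Γ T → SEnv Γ → SV T
  | _, _, .var i, ρ => ρ i
  | _, _, .unit, _ => ()
  | _, _, .pair s t, ρ => (s.seval ρ, t.seval ρ)
  | _, _, .fst t, ρ => (t.seval ρ).1
  | _, _, .snd t, ρ => (t.seval ρ).2

theorem Tm.all_seval {P : Key → Prop} {Γ : List NTy} {T : NTy} (t : Tm Γ T) (e : SEnv Γ)
    (he : e.All P) : SV.All P T (t.seval e) := by
  induction t with
  | var i => rw [Tm.seval]; exact he i
  | unit => trivial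
  | pair s t ih₁ ih₂ => rw [Tm.seval]; exact ⟨ih₁, ih₂⟩
  | fst t ih => rw [Tm.seval]; exact (ih).1
  | snd t ih => rw [Tm.seval]; exact (ih).2

/-- Interpretations of symbolic values which respect tupling. -/
def ienv {U : Type} (I : ∀ T, SV T → NObj U T) {Γ : List NTy} (e : SEnv Γ) : Env U Γ :=
  fun i => I _ (e i)

theorem ienv_cons {U : Type} (I : ∀ T, SV T → NObj U T) {Γ : List NTy} {T : NTy}
    (x : SV T) (e : SEnv Γ) :
    ienv I (SEnv.cons x e) = Env.cons (I T x) (ienv I e) := by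
  funext i
  refine Fin.cases (motive := fun i => ienv I (SEnv.cons x e) i =
    Env.cons (I T x) (ienv I e) i) ?_ ?_ i
  · rfl
  · intro j; rfl

theorem Tm.eval_ienv {U : Type} (I : ∀ T, SV T → NObj U T)
    (hI : ∀ a b (s : SV (.prod a b)), I (.prod a b) s = (I a s.1, I b s.2))
    {Γ : List NTy} {T : NTy} (t : Tm Γ T) (e : SEnv Γ) :
    t.eval (ienv I e) = I T (t.seval e) := by
  induction t with
  | var i => rw [Tm.eval, Tm.seval]; rfl
  | unit => rfl
  | pair s t ih₁ ih₂ =>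
    rw [Tm.eval, Tm.seval, ih₁, ih₂]
    exact (hI _ _ (s.seval e, t.seval e)).symm
  | fst t ih =>
    rw [Tm.eval, Tm.seval, ih]
    exact congrArg Prod.fst (hI _ _ _)
  | snd t ih =>
    rw [Tm.eval, Tm.seval, ih]
    exact congrArg Prod.snd (hI _ _ _)

/-! ### Valuations of names -/

abbrev Val (U : Type) := ∀ T : NTy, Nm → NObj U T

def Neu.ev {U : Type} (v : Val U) : ∀ {T}, Neu T → NObj U T
  | T, .var x => v T x
  | _, .fst n => (n.ev v).1
  | _, .snd n => (n.ev v).2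

def sev {U : Type} (v : Val U) : ∀ T, SV T → NObj U T
  | .ur, n => Neu.ev v (T := .ur) n
  | .unit, _ => ()
  | .prod a b, s => (sev v a s.1, sev v b s.2)
  | .set a, n => Neu.ev v (T := .set a) n

theorem sev_reflect {U : Type} (v : Val U) : ∀ (T : NTy) (n : Neu T),
    sev v T (reflect T n) = n.ev v
  | .ur, _ => rfl
  | .unit, _ => rfl
  | .prod a b, n => by
    have h1 := sev_reflect v a (.fst n)
    have h2 := sev_reflect v b (.snd n)
    show (sev v a (reflect a (.fst n)), sev v b (reflect b (.snd n))) = n.ev v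
    rw [h1, h2]; rfl
  | .set _, _ => rfl

theorem Tm.eval_sev {U : Type} (v : Val U) {Γ : List NTy} {T : NTy} (t : Tm Γ T) (e : SEnv Γ) :
    t.eval (ienv (sev v) e) = sev v T (t.seval e) :=
  Tm.eval_ienv (sev v) (fun _ _ _ => rfl) t e

noncomputable def upd {U : Type} (v : Val U) (T : NTy) (x : Nm) (o : NObj U T) : Val U :=
  fun T' y => if h : T = T' ∧ y = x then h.1 ▸ o else v T' y

theorem upd_self {U : Type} (v : Val U) (T : NTy) (x : Nm) (o : NObj U T) :
    upd v T x o T x = o := by simp [upd]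

theorem ev_upd {U : Type} (v : Val U) (T : NTy) (x : Nm) (o : NObj U T) {S : NTy} (n : Neu S)
    (h : n.key ≠ (x, T)) : n.ev (upd v T x o) = n.ev v := by
  induction n with
  | @var S y =>
    have : ¬ (T = S ∧ y = x) := by
      rintro ⟨rfl, rfl⟩; exact h rfl
    simp [Neu.ev, upd, this]
  | fst n ih => rw [Neu.ev, Neu.ev, ih h]
  | snd n ih => rw [Neu.ev, Neu.ev, ih h]

theorem sev_upd {U : Type} (v : Val U) (T : NTy) (x : Nm) (o : NObj U T) : ∀ (S : NTy) (s : SV S),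
    SV.All (fun k => k ≠ (x, T)) S s → sev (upd v T x o) S s = sev v S s
  | .ur, n, h => ev_upd v T x o (S := .ur) n h
  | .unit, _, _ => rfl
  | .prod a b, s, h => by
    show (sev _ a s.1, sev _ b s.2) = (sev _ a s.1, sev _ b s.2)
    rw [sev_upd v T x o a s.1 h.1, sev_upd v T x o b s.2 h.2]
  | .set a, n, h => ev_upd v T x o (S := .set a) n h

theorem ienv_upd {U : Type} (v : Val U) (T : NTy) (x : Nm) (o : NObj U T) {Γ : List NTy}
    (e : SEnv Γ) (h : e.All (fun k => k ≠ (x, T))) :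
    ienv (sev (upd v T x o)) e = ienv (sev v) e := by
  funext i
  exact sev_upd v T x o _ _ (h i)

/-! ### Formulas -/

def D0.neg : ∀ {Γ}, D0 Γ → D0 Γ
  | _, .eq s t => .ne s t
  | _, .ne s t => .eq s t
  | _, .tru => .fls
  | _, .fls => .tru
  | _, .and φ ψ => .or φ.neg ψ.neg
  | _, .or φ ψ => .and φ.neg ψ.neg
  | _, .all t φ => .ex t φ.neg
  | _, .ex t φ => .all t φ.neg

theorem D0.sat_neg {U : Type} {Γ : List NTy} (φ : D0 Γ) (ρ : Env U Γ) :
    φ.neg.Sat ρ ↔ ¬ φ.Sat ρ := by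
  induction φ with
  | eq s t => simp [D0.neg, D0.Sat]
  | ne s t => simp [D0.neg, D0.Sat]
  | tru => simp [D0.neg, D0.Sat]
  | fls => simp [D0.neg, D0.Sat]
  | and φ ψ ih₁ ih₂ => simp only [D0.neg, D0.Sat, ih₁, ih₂]; tauto
  | or φ ψ ih₁ ih₂ => simp only [D0.neg, D0.Sat, ih₁, ih₂]; tauto
  | all t φ ih => simp only [D0.neg, D0.Sat, ih]; push Not; rfl
  | ex t φ ih => simp only [D0.neg, D0.Sat, ih]; push Not; rfl

theorem D0.fv_neg {Γ : List NTy} (φ : D0 Γ) : φ.neg.fv = φ.fv := by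
  induction φ <;> simp_all [D0.neg, D0.fv]

theorem Tm.eval_congr {U : Type} {Γ : List NTy} {T : NTy} (t : Tm Γ T) (ρ ρ' : Env U Γ)
    (h : ∀ i ∈ t.fv, ρ i = ρ' i) : t.eval ρ = t.eval ρ' := by
  induction t with
  | var i => rw [Tm.eval, Tm.eval]; exact h i (by simp [Tm.fv])
  | unit => rfl
  | pair s t ih₁ ih₂ =>
    rw [Tm.eval, Tm.eval, ih₁ (fun i hi => h i (by simp [Tm.fv, hi])),
      ih₂ (fun i hi => h i (by simp [Tm.fv, hi]))]
  | fst t ih => rw [Tm.eval, Tm.eval, ih (by simpa only [Tm.fv] using h)]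
  | snd t ih => rw [Tm.eval, Tm.eval, ih (by simpa only [Tm.fv] using h)]

theorem Env.cons_congr {U : Type} {Γ : List NTy} {T : NTy} (s : Finset (Fin (Γ.length + 1)))
    (x : NObj U T) (ρ ρ' : Env U Γ) (h : ∀ i ∈ lowerFv s, ρ i = ρ' i) :
    ∀ i : Fin (T :: Γ).length, i ∈ s → Env.cons x ρ i = Env.cons x ρ' i := by
  intro i
  refine Fin.cases (motive := fun i : Fin (T :: Γ).length => i ∈ s →
    Env.cons x ρ i = Env.cons x ρ' i) ?_ ?_ i
  · intro _; rfl
  · intro j hj; exact h j (by simpa [lowerFv] using hj)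

theorem D0.sat_congr {U : Type} {Γ : List NTy} (φ : D0 Γ) (ρ ρ' : Env U Γ)
    (h : ∀ i ∈ φ.fv, ρ i = ρ' i) : φ.Sat ρ ↔ φ.Sat ρ' := by
  induction φ with
  | eq s t =>
    rw [D0.Sat, D0.Sat, s.eval_congr ρ ρ' (fun i hi => h i (by simp [D0.fv, hi])),
      t.eval_congr ρ ρ' (fun i hi => h i (by simp [D0.fv, hi]))]
  | ne s t =>
    rw [D0.Sat, D0.Sat, s.eval_congr ρ ρ' (fun i hi => h i (by simp [D0.fv, hi])),
      t.eval_congr ρ ρ' (fun i hi => h i (by simp [D0.fv, hi]))]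
  | tru => rfl
  | fls => rfl
  | and φ ψ ih₁ ih₂ =>
    rw [D0.Sat, D0.Sat, ih₁ ρ ρ' (fun i hi => h i (by simp [D0.fv, hi])),
      ih₂ ρ ρ' (fun i hi => h i (by simp [D0.fv, hi]))]
  | or φ ψ ih₁ ih₂ =>
    rw [D0.Sat, D0.Sat, ih₁ ρ ρ' (fun i hi => h i (by simp [D0.fv, hi])),
      ih₂ ρ ρ' (fun i hi => h i (by simp [D0.fv, hi]))]
  | all t φ ih =>
    rw [D0.Sat, D0.Sat, t.eval_congr ρ ρ' (fun i hi => h i (by simp [D0.fv, hi]))]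
    refine forall₂_congr (fun x _ => ih _ _ ?_)
    exact Env.cons_congr φ.fv x ρ ρ' (fun i hi => h i (by simp [D0.fv, hi]))
  | ex t φ ih =>
    rw [D0.Sat, D0.Sat, t.eval_congr ρ ρ' (fun i hi => h i (by simp [D0.fv, hi]))]
    refine exists_congr (fun x => and_congr_right (fun _ => ih _ _ ?_))
    exact Env.cons_congr φ.fv x ρ ρ' (fun i hi => h i (by simp [D0.fv, hi]))

/-! ### Terms and Δ₀ formulas as NRC expressions -/

def Tm.toN : ∀ {Γ T}, Tm Γ T → NRC Γ T
  | _, _, .var i => .var i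
  | _, _, .unit => .unit
  | _, _, .pair s t => .pair s.toN t.toN
  | _, _, .fst t => .fst t.toN
  | _, _, .snd t => .snd t.toN

theorem Tm.toN_spec {Γ : List NTy} {T : NTy} (t : Tm Γ T) :
    t.toN.fv = t.fv ∧ t.toN.NoGet ∧
      ∀ (U : Type) [Inhabited U] (ρ : Env U Γ), t.toN.eval ρ = t.eval ρ := by
  induction t with
  | var i => simp [Tm.toN, NRC.fv, Tm.fv, NRC.NoGet, NRC.eval, Tm.eval]
  | unit =>
    refine ⟨by simp [Tm.toN, NRC.fv, Tm.fv], by simp [Tm.toN, NRC.NoGet], ?_⟩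
    intro U _ ρ
    rfl
  | pair s t ih₁ ih₂ =>
    refine ⟨by simp [Tm.toN, NRC.fv, Tm.fv, ih₁.1, ih₂.1], by simp [Tm.toN, NRC.NoGet, ih₁.2.1, ih₂.2.1], ?_⟩
    intro U _ ρ
    rw [Tm.toN, NRC.eval, Tm.eval, ih₁.2.2, ih₂.2.2]
  | fst t ih =>
    refine ⟨by simp [Tm.toN, NRC.fv, Tm.fv, ih.1], by simp [Tm.toN, NRC.NoGet, ih.2.1], ?_⟩
    intro U _ ρ
    rw [Tm.toN, NRC.eval, Tm.eval, ih.2.2]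
  | snd t ih =>
    refine ⟨by simp [Tm.toN, NRC.fv, Tm.fv, ih.1], by simp [Tm.toN, NRC.NoGet, ih.2.1], ?_⟩
    intro U _ ρ
    rw [Tm.toN, NRC.eval, Tm.eval, ih.2.2]

/-- The boolean `true` as an NRC expression. -/
def NRC.top {Γ : List NTy} : NRC Γ (.set .unit) := .sing .unit

/-- A Δ₀ formula as a boolean NRC expression. -/
def D0.toN : ∀ {Γ}, D0 Γ → NRC Γ (.set .unit)
  | _, .eq s t => .diff .top (.bigUnion .top (.diff (.sing s.toN) (.sing t.toN)))
  | _, .ne s t => .bigUnion .top (.diff (.sing s.toN) (.sing t.toN))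
  | _, .tru => .top
  | _, .fls => .empty
  | _, .and φ ψ => .diff .top (.union (.diff .top φ.toN) (.diff .top ψ.toN))
  | _, .or φ ψ => .union φ.toN ψ.toN
  | _, .all t φ => .diff .top (.bigUnion (.diff .top φ.toN) t.toN)
  | _, .ex t φ => .bigUnion φ.toN t.toN

theorem lowerFv_empty {n : ℕ} : lowerFv (∅ : Finset (Fin (n + 1))) = ∅ := by
  simp [lowerFv]

theorem D0.toN_fv {Γ : List NTy} (φ : D0 Γ) : φ.toN.fv ⊆ φ.fv := by
  induction φ with
  | eq s t =>
    simp [D0.toN, NRC.fv, D0.fv, NRC.top, s.toN_spec.1, t.toN_spec.1, lowerFv]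
  | ne s t =>
    simp [D0.toN, NRC.fv, D0.fv, NRC.top, s.toN_spec.1, t.toN_spec.1, lowerFv]
  | tru => simp [D0.toN, NRC.fv, NRC.top]
  | fls => simp [D0.toN, NRC.fv]
  | and φ ψ ih₁ ih₂ =>
    simp only [D0.toN, NRC.fv, NRC.top, D0.fv, Finset.empty_union]
    exact Finset.union_subset_union ih₁ ih₂
  | or φ ψ ih₁ ih₂ =>
    simp only [D0.toN, NRC.fv, D0.fv]
    exact Finset.union_subset_union ih₁ ih₂
  | all t φ ih =>
    simp only [D0.toN, NRC.fv, NRC.top, D0.fv, Finset.empty_union, t.toN_spec.1]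
    rw [Finset.union_comm]
    refine Finset.union_subset_union subset_rfl ?_
    intro i hi
    simp only [lowerFv, Finset.mem_filter] at hi ⊢
    exact ⟨hi.1, ih hi.2⟩
  | ex t φ ih =>
    simp only [D0.toN, NRC.fv, D0.fv, t.toN_spec.1]
    rw [Finset.union_comm]
    refine Finset.union_subset_union subset_rfl ?_
    intro i hi
    simp only [lowerFv, Finset.mem_filter] at hi ⊢
    exact ⟨hi.1, ih hi.2⟩

theorem D0.toN_noGet {Γ : List NTy} (φ : D0 Γ) : φ.toN.NoGet := by
  induction φ with
  | eq s t => exact ⟨trivial, trivial, s.toN_spec.2.1, t.toN_spec.2.1⟩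
  | ne s t => exact ⟨trivial, s.toN_spec.2.1, t.toN_spec.2.1⟩
  | tru => trivial
  | fls => trivial
  | and φ ψ ih₁ ih₂ => exact ⟨trivial, ⟨trivial, ih₁⟩, trivial, ih₂⟩
  | or φ ψ ih₁ ih₂ => exact ⟨ih₁, ih₂⟩
  | all t φ ih => exact ⟨trivial, ⟨trivial, ih⟩, t.toN_spec.2.1⟩
  | ex t φ ih => exact ⟨ih, t.toN_spec.2.1⟩

section NRCMem
variable {U : Type} [Inhabited U] {Γ : List NTy}

theorem NRC.mem_top (ρ : Env U Γ) (u : NObj U .unit) :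
    u ∈ NObj.asSet ((NRC.top : NRC Γ _).eval ρ) := by
  show u = ()
  rfl

theorem NRC.mem_sing {T : NTy} (e : NRC Γ T) (ρ : Env U Γ) (u : NObj U T) :
    u ∈ NObj.asSet ((NRC.sing e).eval ρ) ↔ u = e.eval ρ := Iff.rfl

theorem NRC.mem_empty {T : NTy} (ρ : Env U Γ) (u : NObj U T) :
    u ∈ NObj.asSet ((NRC.empty : NRC Γ _).eval ρ) ↔ False := Iff.rfl

theorem NRC.mem_union {T : NTy} (e f : NRC Γ (.set T)) (ρ : Env U Γ) (u : NObj U T) :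
    u ∈ NObj.asSet ((NRC.union e f).eval ρ) ↔
      u ∈ NObj.asSet (e.eval ρ) ∨ u ∈ NObj.asSet (f.eval ρ) := Iff.rfl

theorem NRC.mem_diff {T : NTy} (e f : NRC Γ (.set T)) (ρ : Env U Γ) (u : NObj U T) :
    u ∈ NObj.asSet ((NRC.diff e f).eval ρ) ↔
      u ∈ NObj.asSet (e.eval ρ) ∧ ¬ u ∈ NObj.asSet (f.eval ρ) := Iff.rfl

theorem NRC.mem_bigUnion {S T : NTy} (e : NRC (S :: Γ) (.set T)) (f : NRC Γ (.set S))
    (ρ : Env U Γ) (u : NObj U T) :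
    u ∈ NObj.asSet ((NRC.bigUnion e f).eval ρ) ↔
      ∃ x ∈ NObj.asSet (f.eval ρ), u ∈ NObj.asSet (e.eval (Env.cons x ρ)) := Iff.rfl

end NRCMem

theorem D0.toN_eval {U : Type} [Inhabited U] {Γ : List NTy} (φ : D0 Γ) (ρ : Env U Γ)
    (u : NObj U .unit) : u ∈ NObj.asSet (φ.toN.eval ρ) ↔ φ.Sat ρ := by
  induction φ with
  | eq s t =>
    simp only [D0.toN, NRC.mem_diff, NRC.mem_bigUnion, NRC.mem_top, NRC.mem_sing, D0.Sat,
      s.toN_spec.2.2, t.toN_spec.2.2]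
    simp
  | ne s t =>
    simp only [D0.toN, NRC.mem_diff, NRC.mem_bigUnion, NRC.mem_top, NRC.mem_sing, D0.Sat,
      s.toN_spec.2.2, t.toN_spec.2.2]
    simp
  | tru => simp only [D0.toN, NRC.mem_top, D0.Sat]
  | fls => simp only [D0.toN, NRC.mem_empty, D0.Sat]
  | and φ ψ ih₁ ih₂ =>
    simp only [D0.toN, NRC.mem_diff, NRC.mem_union, NRC.mem_top, D0.Sat, ih₁, ih₂]
    tauto
  | or φ ψ ih₁ ih₂ =>
    simp only [D0.toN, NRC.mem_union, D0.Sat, ih₁, ih₂]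
  | all t φ ih =>
    simp only [D0.toN, NRC.mem_diff, NRC.mem_bigUnion, NRC.mem_top, D0.Sat, ih,
      t.toN_spec.2.2]
    simp
  | ex t φ ih =>
    simp only [D0.toN, NRC.mem_bigUnion, D0.Sat, ih, t.toN_spec.2.2]

/-- `{z ∈ t : θ(z)}` as an NRC expression. -/
def compr {Γ : List NTy} {T : NTy} (t : Tm Γ (.set T)) (θ : D0 (T :: Γ)) : NRC Γ (.set T) :=
  .bigUnion (.bigUnion (.sing (NRC.var (Γ := .unit :: T :: Γ) (1 : Fin (Γ.length + 2)))) θ.toN)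
    t.toN

theorem compr_fv {Γ : List NTy} {T : NTy} (t : Tm Γ (.set T)) (θ : D0 (T :: Γ)) :
    (compr t θ).fv ⊆ t.fv ∪ lowerFv θ.fv := by
  simp only [compr, NRC.fv, t.toN_spec.1]
  rw [Finset.union_comm]
  refine Finset.union_subset_union subset_rfl ?_
  intro i hi
  simp only [lowerFv, Finset.mem_filter, Finset.mem_union, Finset.mem_singleton] at hi ⊢
  refine ⟨hi.1, ?_⟩
  rcases hi.2 with h | h
  · exfalso
    have := h.2
    have := congrArg Fin.val this
    simp at this
  · exact D0.toN_fv θ h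

theorem compr_noGet {Γ : List NTy} {T : NTy} (t : Tm Γ (.set T)) (θ : D0 (T :: Γ)) :
    (compr t θ).NoGet := ⟨⟨trivial, D0.toN_noGet θ⟩, t.toN_spec.2.1⟩

theorem compr_eval {U : Type} [Inhabited U] {Γ : List NTy} {T : NTy} (t : Tm Γ (.set T))
    (θ : D0 (T :: Γ)) (ρ : Env U Γ) :
    (compr t θ).eval ρ = ({z ∈ NObj.asSet (t.eval ρ) | θ.Sat (Env.cons z ρ)} : Set _) := by
  apply Set.ext
  intro z
  show z ∈ NObj.asSet ((compr t θ).eval ρ) ↔ _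
  simp only [compr, NRC.mem_bigUnion, t.toN_spec.2.2, D0.toN_eval]
  constructor
  · rintro ⟨x, hx, u, hu, hz⟩
    have : z = x := hz
    subst this
    exact ⟨hx, hu⟩
  · rintro ⟨hz, hs⟩
    exact ⟨z, hz, (), hs, rfl⟩

/-! ### Separation -/

abbrev VP := ∀ (U : Type) [Inhabited U], Val U → Prop

def Separ {Tz : NTy} (Lam : ∀ U : Type, Val U → Set (NObj U Tz)) (Δ : List NTy) (e : SEnv Δ)
    (A : Finset (Fin Δ.length)) (PL PR : VP) : Prop :=
  ∃ (θ : D0 Δ) (E : NRC Δ (.set (.set Tz))), θ.fv ⊆ A ∧ E.fv ⊆ A ∧ E.NoGet ∧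
    (∀ (U : Type) [Inhabited U] (v : Val U), PL U v →
      θ.Sat (ienv (sev v) e) ∨ Lam U v ∈ NObj.asSet (E.eval (ienv (sev v) e))) ∧
    (∀ (U : Type) [Inhabited U] (v : Val U), PR U v → ¬ θ.Sat (ienv (sev v) e))

def liftA {n : ℕ} (A : Finset (Fin n)) : Finset (Fin (n + 1)) := insert 0 (A.image Fin.succ)

theorem lowerFv_liftA {n : ℕ} {A : Finset (Fin n)} {s : Finset (Fin (n + 1))}
    (h : s ⊆ liftA A) : lowerFv s ⊆ A := by
  intro i hi
  simp only [lowerFv, Finset.mem_filter] at hi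
  have := h hi.2
  simpa [liftA, Fin.succ_ne_zero] using this

section SepLemmas
variable {Tz : NTy} {Lam : ∀ U : Type, Val U → Set (NObj U Tz)} {Δ : List NTy} {e : SEnv Δ}
  {A : Finset (Fin Δ.length)}

theorem sep_of_unsatL {PL PR : VP} (h : ∀ (U : Type) [Inhabited U] (v : Val U), ¬ PL U v) :
    Separ Lam Δ e A PL PR :=
  ⟨.fls, .empty, by simp [D0.fv], by simp [NRC.fv], trivial,
    fun U _ v hv => (h U v hv).elim, fun U _ v _ h => h⟩

theorem sep_of_unsatR {PL PR : VP} (h : ∀ (U : Type) [Inhabited U] (v : Val U), ¬ PR U v) :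
    Separ Lam Δ e A PL PR :=
  ⟨.tru, .empty, by simp [D0.fv], by simp [NRC.fv], trivial,
    fun U _ v hv => Or.inl trivial, fun U _ v hv _ => h U v hv⟩

theorem sep_mono {PL PR PL' PR' : VP} (h : Separ Lam Δ e A PL' PR')
    (hL : ∀ (U : Type) [Inhabited U] (v : Val U), PL U v → ∃ v', PL' U v' ∧
      ienv (sev v') e = ienv (sev v) e ∧ Lam U v' = Lam U v)
    (hR : ∀ (U : Type) [Inhabited U] (v : Val U), PR U v → ∃ v', PR' U v' ∧
      ienv (sev v') e = ienv (sev v) e ∧ Lam U v' = Lam U v) : Separ Lam Δ e A PL PR := by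
  obtain ⟨θ, E, h1, h2, h3, h4, h5⟩ := h
  refine ⟨θ, E, h1, h2, h3, ?_, ?_⟩
  · intro U _ v hv
    obtain ⟨v', hv', he, hl⟩ := hL U v hv
    have := h4 U v' hv'
    rwa [he, hl] at this
  · intro U _ v hv
    obtain ⟨v', hv', he, hl⟩ := hR U v hv
    have := h5 U v' hv'
    rwa [he] at this

theorem sep_splitL {PL PR PL1 PR1 PL2 PR2 : VP}
    (h1 : Separ Lam Δ e A PL1 PR1) (h2 : Separ Lam Δ e A PL2 PR2)
    (hL : ∀ (U : Type) [Inhabited U] (v : Val U), PL U v → PL1 U v ∨ PL2 U v)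
    (hR : ∀ (U : Type) [Inhabited U] (v : Val U), PR U v → PR1 U v ∧ PR2 U v) :
    Separ Lam Δ e A PL PR := by
  obtain ⟨θ, E, a1, a2, a3, a4, a5⟩ := h1
  obtain ⟨θ', E', b1, b2, b3, b4, b5⟩ := h2
  refine ⟨.or θ θ', .union E E', ?_, ?_, ⟨a3, b3⟩, ?_, ?_⟩
  · simp only [D0.fv]; exact Finset.union_subset a1 b1
  · simp only [NRC.fv]; exact Finset.union_subset a2 b2
  · intro U _ v hv
    simp only [D0.Sat]
    rcases hL U v hv with h | h
    · have := a4 U v h; tauto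
    · have := b4 U v h; tauto
  · intro U _ v hv
    simp only [D0.Sat]
    have := a5 U v (hR U v hv).1
    have := b5 U v (hR U v hv).2
    tauto

theorem sep_splitR {PL PR PL1 PR1 PL2 PR2 : VP}
    (h1 : Separ Lam Δ e A PL1 PR1) (h2 : Separ Lam Δ e A PL2 PR2)
    (hL : ∀ (U : Type) [Inhabited U] (v : Val U), PL U v → PL1 U v ∧ PL2 U v)
    (hR : ∀ (U : Type) [Inhabited U] (v : Val U), PR U v → PR1 U v ∨ PR2 U v) :
    Separ Lam Δ e A PL PR := by
  obtain ⟨θ, E, a1, a2, a3, a4, a5⟩ := h1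
  obtain ⟨θ', E', b1, b2, b3, b4, b5⟩ := h2
  refine ⟨.and θ θ', .union E E', ?_, ?_, ⟨a3, b3⟩, ?_, ?_⟩
  · simp only [D0.fv]; exact Finset.union_subset a1 b1
  · simp only [NRC.fv]; exact Finset.union_subset a2 b2
  · intro U _ v hv
    simp only [D0.Sat]
    have := a4 U v (hL U v hv).1
    have := b4 U v (hL U v hv).2
    tauto
  · intro U _ v hv
    simp only [D0.Sat]
    rcases hR U v hv with h | h
    · have := a5 U v h; tauto
    · have := b5 U v h; tauto

theorem sep_cut {PL PR PL1 PR1 PL2 PR2 : VP} (σ : D0 Δ) (hσ : σ.fv ⊆ A)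
    (h1 : Separ Lam Δ e A PL1 PR1) (h2 : Separ Lam Δ e A PL2 PR2)
    (hL1 : ∀ (U : Type) [Inhabited U] (v : Val U), PL U v → σ.Sat (ienv (sev v) e) → PL1 U v)
    (hL2 : ∀ (U : Type) [Inhabited U] (v : Val U), PL U v → ¬ σ.Sat (ienv (sev v) e) → PL2 U v)
    (hR1 : ∀ (U : Type) [Inhabited U] (v : Val U), PR U v → σ.Sat (ienv (sev v) e) → PR1 U v)
    (hR2 : ∀ (U : Type) [Inhabited U] (v : Val U), PR U v → ¬ σ.Sat (ienv (sev v) e) → PR2 U v) :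
    Separ Lam Δ e A PL PR := by
  obtain ⟨θ, E, a1, a2, a3, a4, a5⟩ := h1
  obtain ⟨θ', E', b1, b2, b3, b4, b5⟩ := h2
  refine ⟨.or (.and σ θ) (.and σ.neg θ'), .union E E', ?_, ?_, ⟨a3, b3⟩, ?_, ?_⟩
  · simp only [D0.fv, D0.fv_neg]
    exact Finset.union_subset (Finset.union_subset hσ a1) (Finset.union_subset hσ b1)
  · simp only [NRC.fv]; exact Finset.union_subset a2 b2
  · intro U _ v hv
    simp only [D0.Sat, D0.sat_neg]
    by_cases h : σ.Sat (ienv (sev v) e)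
    · have := a4 U v (hL1 U v hv h); tauto
    · have := b4 U v (hL2 U v hv h); tauto
  · intro U _ v hv
    simp only [D0.Sat, D0.sat_neg]
    by_cases h : σ.Sat (ienv (sev v) e)
    · have := a5 U v (hR1 U v hv h); tauto
    · have := b5 U v (hR2 U v hv h); tauto

theorem ienv_push {U : Type} (v : Val U) {T : NTy} (x : Nm) (o : NObj U T)
    (hfr : e.All (fun k => k ≠ (x, T))) :
    ienv (sev (upd v T x o)) (SEnv.cons (reflect T (.var x)) e) =
      Env.cons o (ienv (sev v) e) := by
  rw [ienv_cons, sev_reflect, ienv_upd v T x o e hfr]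
  congr 1
  exact upd_self v T x o

theorem sep_exL {PL PR PL' PR' : VP} {T : NTy} (t : Tm Δ (.set T)) (ht : t.fv ⊆ A) (x : Nm)
    (hfr : e.All (fun k => k ≠ (x, T)))
    (hLam : ∀ (U : Type) (v : Val U) (o : NObj U T), Lam U (upd v T x o) = Lam U v)
    (h : Separ Lam (T :: Δ) (SEnv.cons (reflect T (.var x)) e) (liftA A) PL' PR')
    (hL : ∀ (U : Type) [Inhabited U] (v : Val U), PL U v →
      ∃ o ∈ NObj.asSet (t.eval (ienv (sev v) e)), PL' U (upd v T x o))
    (hR : ∀ (U : Type) [Inhabited U] (v : Val U), PR U v →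
      ∀ o ∈ NObj.asSet (t.eval (ienv (sev v) e)), PR' U (upd v T x o)) :
    Separ Lam Δ e A PL PR := by
  obtain ⟨θ, E, a1, a2, a3, a4, a5⟩ := h
  refine ⟨.ex t θ, .bigUnion E t.toN, ?_, ?_, ⟨a3, t.toN_spec.2.1⟩, ?_, ?_⟩
  · simp only [D0.fv]; exact Finset.union_subset ht (lowerFv_liftA a1)
  · simp only [NRC.fv, t.toN_spec.1]; exact Finset.union_subset (lowerFv_liftA a2) ht
  · intro U _ v hv
    simp only [D0.Sat]
    obtain ⟨o, ho, hp⟩ := hL U v hv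
    have := a4 U _ hp
    rw [ienv_push v x o hfr, hLam] at this
    rcases this with h | h
    · exact Or.inl ⟨o, ho, h⟩
    · exact Or.inr ⟨o, by rw [t.toN_spec.2.2]; exact ho, h⟩
  · intro U _ v hv
    simp only [D0.Sat]
    rintro ⟨o, ho, hs⟩
    have := a5 U _ (hR U v hv o ho)
    rw [ienv_push v x o hfr] at this
    exact this hs

theorem sep_exR {PL PR PL' PR' : VP} {T : NTy} (t : Tm Δ (.set T)) (ht : t.fv ⊆ A) (x : Nm)
    (hfr : e.All (fun k => k ≠ (x, T)))
    (hLam : ∀ (U : Type) (v : Val U) (o : NObj U T), Lam U (upd v T x o) = Lam U v)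
    (h : Separ Lam (T :: Δ) (SEnv.cons (reflect T (.var x)) e) (liftA A) PL' PR')
    (hL : ∀ (U : Type) [Inhabited U] (v : Val U), PL U v →
      ∀ o ∈ NObj.asSet (t.eval (ienv (sev v) e)), PL' U (upd v T x o))
    (hR : ∀ (U : Type) [Inhabited U] (v : Val U), PR U v →
      ∃ o ∈ NObj.asSet (t.eval (ienv (sev v) e)), PR' U (upd v T x o)) :
    Separ Lam Δ e A PL PR := by
  obtain ⟨θ, E, a1, a2, a3, a4, a5⟩ := h
  refine ⟨.all t θ, .bigUnion E t.toN, ?_, ?_, ⟨a3, t.toN_spec.2.1⟩, ?_, ?_⟩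
  · simp only [D0.fv]; exact Finset.union_subset ht (lowerFv_liftA a1)
  · simp only [NRC.fv, t.toN_spec.1]; exact Finset.union_subset (lowerFv_liftA a2) ht
  · intro U _ v hv
    simp only [D0.Sat]
    by_cases hall : ∀ o ∈ NObj.asSet (t.eval (ienv (sev v) e)),
        θ.Sat (Env.cons o (ienv (sev v) e))
    · exact Or.inl hall
    · push Not at hall
      obtain ⟨o, ho, hn⟩ := hall
      have := a4 U _ (hL U v hv o ho)
      rw [ienv_push v x o hfr, hLam] at this
      rcases this with h | h
      · exact (hn h).elim
      · exact Or.inr ⟨o, by rw [t.toN_spec.2.2]; exact ho, h⟩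
  · intro U _ v hv
    simp only [D0.Sat]
    intro hs
    obtain ⟨o, ho, hp⟩ := hR U v hv
    have := a5 U _ hp
    rw [ienv_push v x o hfr] at this
    exact this (hs o ho)

theorem sep_goal {PL PR PL1 PR1 PL2 PR2 : VP} (t : Tm Δ (.set Tz)) (ht : t.fv ⊆ A) (x : Nm)
    (hfr : e.All (fun k => k ≠ (x, Tz)))
    (hLam : ∀ (U : Type) (v : Val U) (o : NObj U Tz), Lam U (upd v Tz x o) = Lam U v)
    (hLt : ∀ (U : Type) (v : Val U), Lam U v ⊆ NObj.asSet (t.eval (ienv (sev v) e)))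
    (h1 : Separ Lam (Tz :: Δ) (SEnv.cons (reflect Tz (.var x)) e) (liftA A) PL1 PR1)
    (h2 : Separ Lam (Tz :: Δ) (SEnv.cons (reflect Tz (.var x)) e) (liftA A) PL2 PR2)
    (hL1 : ∀ (U : Type) [Inhabited U] (v : Val U), PL U v →
      ∀ o ∈ NObj.asSet (t.eval (ienv (sev v) e)), o ∈ Lam U v → PL1 U (upd v Tz x o))
    (hL2 : ∀ (U : Type) [Inhabited U] (v : Val U), PL U v →
      ∀ o ∈ NObj.asSet (t.eval (ienv (sev v) e)), o ∉ Lam U v → PL2 U (upd v Tz x o))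
    (hR : ∀ (U : Type) [Inhabited U] (v : Val U), PR U v →
      ∀ o ∈ NObj.asSet (t.eval (ienv (sev v) e)),
        PR1 U (upd v Tz x o) ∨ PR2 U (upd v Tz x o)) :
    Separ Lam Δ e A PL PR := by
  obtain ⟨θ, E, a1, a2, a3, a4, a5⟩ := h1
  obtain ⟨θ', E', b1, b2, b3, b4, b5⟩ := h2
  refine ⟨.ex t (.and θ θ'), .union (.bigUnion (.union E E') t.toN) (.sing (compr t θ)),
    ?_, ?_, ⟨⟨⟨a3, b3⟩, t.toN_spec.2.1⟩, compr_noGet t θ⟩, ?_, ?_⟩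
  · simp only [D0.fv]
    exact Finset.union_subset ht (lowerFv_liftA (Finset.union_subset a1 b1))
  · simp only [NRC.fv, t.toN_spec.1]
    refine Finset.union_subset
      (Finset.union_subset (lowerFv_liftA (Finset.union_subset a2 b2)) ht) ?_
    exact (compr_fv t θ).trans (Finset.union_subset ht (lowerFv_liftA a1))
  · intro U _ v hv
    by_cases hE : ∃ o ∈ NObj.asSet (t.eval (ienv (sev v) e)),
        Lam U v ∈ NObj.asSet (E.eval (Env.cons o (ienv (sev v) e))) ∨
        Lam U v ∈ NObj.asSet (E'.eval (Env.cons o (ienv (sev v) e)))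
    · refine Or.inr (Or.inl ?_)
      obtain ⟨o, ho, hh⟩ := hE
      refine ⟨o, ?_, hh⟩
      rw [t.toN_spec.2.2]; exact ho
    · push Not at hE
      have k1 : ∀ o ∈ Lam U v, θ.Sat (Env.cons o (ienv (sev v) e)) := by
        intro o ho
        have ho' := hLt U v ho
        have := a4 U _ (hL1 U v hv o ho' ho)
        rw [ienv_push v x o hfr, hLam] at this
        exact this.resolve_right (hE o ho').1
      have k2 : ∀ o ∈ NObj.asSet (t.eval (ienv (sev v) e)), o ∉ Lam U v →
          θ'.Sat (Env.cons o (ienv (sev v) e)) := by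
        intro o ho' ho
        have := b4 U _ (hL2 U v hv o ho' ho)
        rw [ienv_push v x o hfr, hLam] at this
        exact this.resolve_right (hE o ho').2
      by_cases hc : ∃ o ∈ NObj.asSet (t.eval (ienv (sev v) e)), o ∉ Lam U v ∧
          θ.Sat (Env.cons o (ienv (sev v) e))
      · obtain ⟨o, ho, ho', hs⟩ := hc
        exact Or.inl ⟨o, ho, hs, k2 o ho ho'⟩
      · push Not at hc
        refine Or.inr (Or.inr ?_)
        show Lam U v = (compr t θ).eval (ienv (sev v) e)
        rw [compr_eval]
        apply Set.ext
        intro o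
        constructor
        · intro ho; exact ⟨hLt U v ho, k1 o ho⟩
        · rintro ⟨ho, hs⟩
          by_contra hn
          exact hc o ho hn hs
  · intro U _ v hv
    simp only [D0.Sat]
    rintro ⟨o, ho, hs, hs'⟩
    rcases hR U v hv o ho with h | h
    · have := a5 U _ h
      rw [ienv_push v x o hfr] at this
      exact this hs
    · have := b5 U _ h
      rw [ienv_push v x o hfr] at this
      exact this hs'

end SepLemmas

/-! ### Stages of the construction -/

def Ok (X : Bool) : Col → Prop
  | .c => True
  | .l => X = true
  | .r => X = false

def priv (X : Bool) : Col := if X then .l else .r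

theorem ok_priv (X : Bool) : Ok X (priv X) := by cases X <;> simp [Ok, priv]

theorem priv_ne (X : Bool) : priv X ≠ Col.c := by cases X <;> simp [priv]

theorem not_ok_of_ne {X : Bool} {k : Col} (hk : k ≠ .c) (h : Ok X k) : ∀ Y, Ok Y k → Y = X := by
  intro Y hY
  cases k
  · exact (hk rfl).elim
  · exact hY.trans h.symm
  · exact hY.trans h.symm

theorem eq_c_of_ok {k : Col} (h : Ok true k) (h' : Ok false k) : k = .c := by
  cases k
  · rfl
  · cases h'
  · cases h

abbrev Form := Σ Γ : List NTy, D0 Γ × SEnv Γ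
abbrev Mem := Σ T : NTy, Neu (.set T) × Nm

def Form.Sat {U : Type} (f : Form) (v : Val U) : Prop := f.2.1.Sat (ienv (sev v) f.2.2)

def Mem.Sat {U : Type} (X : Bool) (m : Mem) (v : Val U) : Prop :=
  Ok X m.2.1.key.1.1 → v m.1 m.2.2 ∈ NObj.asSet (m.2.1.ev v)

structure Par where
  Γ : List NTy
  Tz : NTy
  Ty : NTy
  cx : ℕ
  eL : SEnv Γ
  eR : SEnv Γ
  lam : D0 (Tz :: Γ)
  rho : D0 (Tz :: Ty :: Γ)

def Par.cN (P : Par) : Neu (.set P.Tz) := .var (.c, P.cx)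

def Par.Lam (P : Par) (U : Type) (v : Val U) : Set (NObj U P.Tz) :=
  {z ∈ NObj.asSet (P.cN.ev v) | P.lam.Sat (Env.cons z (ienv (sev v) P.eL))}

structure Stage where
  Δ : List NTy
  e : SEnv Δ
  A : Finset (Fin Δ.length)
  K : Set Key
  Th : Bool → Set Form
  M : Set Mem

def KOk (X : Bool) (K : Set Key) (k : Key) : Prop := Ok X k.1.1 ∧ k ∈ K

theorem KOk.mono {X : Bool} {K K' : Set Key} (h : K ⊆ K') (k : Key) (hk : KOk X K k) :
    KOk X K' k := ⟨hk.1, h hk.2⟩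

structure WF (P : Par) (st : Stage) : Prop where
  fin : st.K.Finite
  forms : ∀ X, ∀ f ∈ st.Th X, f.2.2.All (KOk X st.K)
  mems : ∀ m ∈ st.M, m.2.1.key ∈ st.K ∧ (m.2.2, m.1) ∈ st.K ∧
    ∀ X, Ok X m.2.1.key.1.1 → Ok X m.2.2.1
  env : st.e.All (fun k => k ∈ st.K)
  terms : ∀ T (x : Nm), (x, T) ∈ st.K → x.1 = .c →
    ∃ t : Tm st.Δ T, t.fv ⊆ st.A ∧ t.seval st.e = reflect T (.var x)
  eLok : P.eL.All (KOk true st.K)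
  eRok : P.eR.All (KOk false st.K)
  cok : P.cN.key ∈ st.K

def Stage.Mod (st : Stage) (X : Bool) : VP := fun _ _ v =>
  (∀ f ∈ st.Th X, Form.Sat f v) ∧ ∀ m ∈ st.M, Mem.Sat X m v

def Stage.Sepd (P : Par) (st : Stage) : Prop :=
  Separ P.Lam st.Δ st.e st.A (st.Mod true) (st.Mod false)

def Good (P : Par) (st : Stage) : Prop := WF P st ∧ ¬ st.Sepd P

def Stage.Le (st st' : Stage) : Prop :=
  st.K ⊆ st'.K ∧ (∀ X, st.Th X ⊆ st'.Th X) ∧ st.M ⊆ st'.M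

theorem Stage.Le.refl (st : Stage) : st.Le st := ⟨subset_rfl, fun _ => subset_rfl, subset_rfl⟩

theorem Stage.Le.trans {a b c : Stage} (h : a.Le b) (h' : b.Le c) : a.Le c :=
  ⟨h.1.trans h'.1, fun X => (h.2.1 X).trans (h'.2.1 X), h.2.2.trans h'.2.2⟩

def Stage.ext (st : Stage) (K' : Set Key) (G : Bool → Set Form) (M' : Set Mem) : Stage :=
  { st with K := st.K ∪ K', Th := fun X => st.Th X ∪ G X, M := st.M ∪ M' }

def Stage.push (st : Stage) (T : NTy) (x : Nm) : Stage :=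
  { st with
    Δ := T :: st.Δ
    e := SEnv.cons (reflect T (.var x)) st.e
    A := liftA st.A
    K := insert (x, T) st.K }

theorem Stage.le_ext (st : Stage) (K' : Set Key) (G : Bool → Set Form) (M' : Set Mem) :
    st.Le (st.ext K' G M') :=
  ⟨Set.subset_union_left, fun _ => Set.subset_union_left, Set.subset_union_left⟩

theorem Stage.le_push (st : Stage) (T : NTy) (x : Nm) : st.Le (st.push T x) :=
  ⟨Set.subset_insert _ _, fun _ => subset_rfl, subset_rfl⟩

theorem Stage.mod_ext {U : Type} [Inhabited U] (st : Stage) (K' : Set Key)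
    (G : Bool → Set Form) (M' : Set Mem) (X : Bool) (v : Val U) :
    (st.ext K' G M').Mod X U v ↔
      st.Mod X U v ∧ (∀ f ∈ G X, Form.Sat f v) ∧ ∀ m ∈ M', Mem.Sat X m v := by
  constructor
  · rintro ⟨h1, h2⟩
    exact ⟨⟨fun f hf => h1 f (Or.inl hf), fun m hm => h2 m (Or.inl hm)⟩,
      fun f hf => h1 f (Or.inr hf), fun m hm => h2 m (Or.inr hm)⟩
  · rintro ⟨⟨h1, h2⟩, h3, h4⟩
    exact ⟨fun f hf => hf.elim (h1 f) (h3 f), fun m hm => hm.elim (h2 m) (h4 m)⟩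

theorem WF.ext {P : Par} {st : Stage} (h : WF P st) {K' : Set Key} {G : Bool → Set Form}
    {M' : Set Mem} (hK : K'.Finite) (hc : ∀ k ∈ K', k.1.1 ≠ .c)
    (hG : ∀ X, ∀ f ∈ G X, f.2.2.All (KOk X (st.K ∪ K')))
    (hM : ∀ m ∈ M', m.2.1.key ∈ st.K ∪ K' ∧ (m.2.2, m.1) ∈ st.K ∪ K' ∧
      ∀ X, Ok X m.2.1.key.1.1 → Ok X m.2.2.1) : WF P (st.ext K' G M') where
  fin := h.fin.union hK
  forms := by
    rintro X f (hf | hf)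
    · exact (h.forms X f hf).mono (KOk.mono Set.subset_union_left)
    · exact hG X f hf
  mems := by
    rintro m (hm | hm)
    · obtain ⟨h1, h2, h3⟩ := h.mems m hm
      exact ⟨Or.inl h1, Or.inl h2, h3⟩
    · exact hM m hm
  env := h.env.mono (fun k hk => Or.inl hk)
  terms := by
    rintro T x (hx | hx) hxc
    · exact h.terms T x hx hxc
    · exact (hc _ hx hxc).elim
  eLok := h.eLok.mono (KOk.mono Set.subset_union_left)
  eRok := h.eRok.mono (KOk.mono Set.subset_union_left)
  cok := Or.inl h.cok

def Tm.weak (S : NTy) {Γ : List NTy} : ∀ {T : NTy}, Tm Γ T → Tm (S :: Γ) T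
  | _, .var i => Tm.var (Γ := S :: Γ) i.succ
  | _, .unit => .unit
  | _, .pair s t => .pair (s.weak S) (t.weak S)
  | _, .fst t => .fst (t.weak S)
  | _, .snd t => .snd (t.weak S)

theorem Tm.weak_fv (S : NTy) {Γ : List NTy} {T : NTy} (t : Tm Γ T) :
    (t.weak S).fv = t.fv.image Fin.succ := by
  induction t with
  | var i => simp [Tm.weak, Tm.fv]
  | unit => simp [Tm.weak, Tm.fv]
  | pair s t ih₁ ih₂ => simp only [Tm.weak, Tm.fv, ih₁, ih₂, Finset.image_union]
  | fst t ih => simp only [Tm.weak, Tm.fv, ih]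
  | snd t ih => simp only [Tm.weak, Tm.fv, ih]

theorem Tm.weak_seval (S : NTy) {Γ : List NTy} {T : NTy} (t : Tm Γ T) (s : SV S) (e : SEnv Γ) :
    (t.weak S).seval (SEnv.cons s e) = t.seval e := by
  induction t with
  | var i => rw [Tm.weak, Tm.seval, Tm.seval]; rfl
  | unit => rfl
  | pair a b ih₁ ih₂ => rw [Tm.weak, Tm.seval, Tm.seval, ih₁, ih₂]
  | fst t ih => rw [Tm.weak, Tm.seval, Tm.seval, ih]
  | snd t ih => rw [Tm.weak, Tm.seval, Tm.seval, ih]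

def Tm.zero (S : NTy) (Γ : List NTy) : Tm (S :: Γ) S :=
  Tm.var (Γ := S :: Γ) (0 : Fin (Γ.length + 1))

theorem Tm.zero_fv (S : NTy) (Γ : List NTy) : (Tm.zero S Γ).fv = {(0 : Fin (Γ.length + 1))} := by
  have : ∀ i : Fin (S :: Γ).length, (Tm.var (Γ := S :: Γ) i).fv = {i} := by
    intro i; rw [Tm.fv]
  exact this (0 : Fin (Γ.length + 1))

theorem Tm.zero_seval (S : NTy) (Γ : List NTy) (s : SV S) (e : SEnv Γ) :
    (Tm.zero S Γ).seval (SEnv.cons s e) = s := by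
  have : ∀ i : Fin (S :: Γ).length, (Tm.var (Γ := S :: Γ) i).seval (SEnv.cons s e) =
      SEnv.cons s e i := by
    intro i; rw [Tm.seval]
  exact this (0 : Fin (Γ.length + 1))

theorem WF.push {P : Par} {st : Stage} (h : WF P st) (T : NTy) (x : Nm) :
    WF P (st.push T x) where
  fin := h.fin.insert _
  forms := fun X f hf => (h.forms X f hf).mono (KOk.mono (Set.subset_insert _ _))
  mems := by
    intro m hm
    obtain ⟨h1, h2, h3⟩ := h.mems m hm
    exact ⟨Or.inr h1, Or.inr h2, h3⟩
  env := SEnv.all_cons (SV.all_reflect _ _ (Or.inl rfl)) (h.env.mono (fun k hk => Or.inr hk))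
  terms := by
    rintro S y (hy | hy) hyc
    · cases hy
      refine ⟨Tm.zero T st.Δ, ?_, Tm.zero_seval T st.Δ _ _⟩
      have := Tm.zero_fv T st.Δ
      refine (Finset.subset_of_eq this).trans ?_
      simp [Stage.push, liftA]
    · obtain ⟨t, ht, hte⟩ := h.terms S y hy hyc
      refine ⟨t.weak T, ?_, ?_⟩
      · refine (Finset.subset_of_eq (Tm.weak_fv T t)).trans ?_
        exact (Finset.image_subset_image ht).trans (Finset.subset_insert _ _)
      · exact (Tm.weak_seval T t _ st.e).trans hte
  eLok := h.eLok.mono (KOk.mono (Set.subset_insert _ _))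
  eRok := h.eRok.mono (KOk.mono (Set.subset_insert _ _))
  cok := Or.inr h.cok

theorem WF.exists_tm {P : Par} {st : Stage} (h : WF P st) {T : NTy} (n : Neu T)
    (hn : n.key ∈ st.K) (hc : n.key.1.1 = .c) :
    ∃ t : Tm st.Δ T, t.fv ⊆ st.A ∧ t.seval st.e = reflect T n := by
  induction n with
  | var x => exact h.terms _ x hn hc
  | fst n ih =>
    obtain ⟨t, h1, h2⟩ := ih hn hc
    refine ⟨.fst t, by simpa only [Tm.fv] using h1, ?_⟩
    rw [Tm.seval, h2]; rfl
  | snd n ih =>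
    obtain ⟨t, h1, h2⟩ := ih hn hc
    refine ⟨.snd t, by simpa only [Tm.fv] using h1, ?_⟩
    rw [Tm.seval, h2]; rfl

theorem SEnv.All.fresh {Γ : List NTy} {e : SEnv Γ} {K : Set Key} {k₀ : Key} (h₀ : k₀ ∉ K)
    {Q : Key → Prop} (hQ : ∀ k, Q k → k ∈ K) (h : e.All Q) : e.All (fun k => k ≠ k₀) :=
  h.mono (fun k hk (he : k = k₀) => h₀ (he ▸ hQ k hk))

theorem WF.mod_upd {P : Par} {st : Stage} (h : WF P st) {T : NTy} {x : Nm}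
    (hx : (x, T) ∉ st.K) {U : Type} [Inhabited U] (X : Bool) (v : Val U) (o : NObj U T)
    (hm : st.Mod X U v) : st.Mod X U (upd v T x o) := by
  refine ⟨?_, ?_⟩
  · intro f hf
    have := hm.1 f hf
    rw [Form.Sat] at this ⊢
    rwa [ienv_upd v T x o _ ((h.forms X f hf).fresh hx (fun k hk => hk.2))]
  · intro m hm' hok
    have h1 := hm.2 m hm' hok
    obtain ⟨h2, h3, _⟩ := h.mems m hm'
    rw [ev_upd v T x o _ (fun he => hx (he ▸ h2))]
    have := ev_upd v T x o (S := m.1) (.var m.2.2) (fun he => hx (he ▸ h3))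
    rw [Neu.ev, Neu.ev] at this
    rwa [this]

theorem WF.lam_upd {P : Par} {st : Stage} (h : WF P st) {T : NTy} {x : Nm}
    (hx : (x, T) ∉ st.K) {U : Type} (v : Val U) (o : NObj U T) :
    P.Lam U (upd v T x o) = P.Lam U v := by
  unfold Par.Lam
  rw [ev_upd v T x o _ (fun he => hx (he ▸ h.cok)),
    ienv_upd v T x o _ (h.eLok.fresh hx (fun k hk => hk.2))]

theorem WF.exists_fresh {P : Par} {st : Stage} (h : WF P st) (k : Col) (T : NTy) :
    ∃ n : ℕ, (((k, n), T) : Key) ∉ st.K := by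
  by_contra hc
  push Not at hc
  have hinj : Function.Injective (fun n : ℕ => (((k, n), T) : Key)) := by
    intro a b hab
    simpa using hab
  have := Set.infinite_range_of_injective hinj
  exact this (h.fin.subset (by rintro _ ⟨n, rfl⟩; exact hc n))

/-! ### Adding formulas -/

def Stage.addF (st : Stage) (X : Bool) (f : Form) : Stage :=
  st.ext ∅ (fun Y => {g | Y = X ∧ g = f}) ∅

theorem Stage.mem_addF (st : Stage) (X : Bool) (f : Form) : f ∈ (st.addF X f).Th X :=
  Or.inr ⟨rfl, rfl⟩

theorem WF.addF {P : Par} {st : Stage} (h : WF P st) {X : Bool} {f : Form}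
    (hf : f.2.2.All (KOk X st.K)) : WF P (st.addF X f) := by
  refine h.ext Set.finite_empty (by simp) ?_ (by simp)
  rintro Y g ⟨rfl, rfl⟩
  exact hf.mono (KOk.mono Set.subset_union_left)

theorem Stage.mod_addF {U : Type} [Inhabited U] (st : Stage) (X : Bool) (f : Form) (Y : Bool)
    (v : Val U) : (st.addF X f).Mod Y U v ↔ st.Mod Y U v ∧ (Y = X → Form.Sat f v) := by
  rw [Stage.addF, Stage.mod_ext]
  constructor
  · rintro ⟨h1, h2, _⟩; exact ⟨h1, fun h => h2 f ⟨h, rfl⟩⟩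
  · rintro ⟨h1, h2⟩
    refine ⟨h1, ?_, fun m hm => hm.elim⟩
    rintro g ⟨hY, rfl⟩; exact h2 hY

theorem Good.split {P : Par} {st : Stage} (h : Good P st) (X : Bool) (f g : Form)
    (hf : f.2.2.All (KOk X st.K)) (hg : g.2.2.All (KOk X st.K))
    (hfg : ∀ (U : Type) [Inhabited U] (v : Val U), st.Mod X U v → Form.Sat f v ∨ Form.Sat g v) :
    Good P (st.addF X f) ∨ Good P (st.addF X g) := by
  by_contra hc
  rw [not_or] at hc
  have h1 : (st.addF X f).Sepd P := by
    by_contra hn; exact hc.1 ⟨h.1.addF hf, hn⟩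
  have h2 : (st.addF X g).Sepd P := by
    by_contra hn; exact hc.2 ⟨h.1.addF hg, hn⟩
  apply h.2
  cases X with
  | true =>
    refine sep_splitL h1 h2 ?_ ?_
    · intro U _ v hv
      simp only [Stage.mod_addF]
      have := hfg U v hv
      tauto
    · intro U _ v hv
      simp only [Stage.mod_addF]
      simp [hv]
  | false =>
    refine sep_splitR h1 h2 ?_ ?_
    · intro U _ v hv
      simp only [Stage.mod_addF]
      simp [hv]
    · intro U _ v hv
      simp only [Stage.mod_addF]
      have := hfg U v hv
      tauto

theorem Good.add {P : Par} {st : Stage} (h : Good P st) (X : Bool) (f : Form)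
    (hf : f.2.2.All (KOk X st.K))
    (hfg : ∀ (U : Type) [Inhabited U] (v : Val U), st.Mod X U v → Form.Sat f v) :
    Good P (st.addF X f) := by
  rcases h.split X f f hf hf (fun U _ v hv => Or.inl (hfg U v hv)) with h | h <;> exact h

theorem Good.sat {P : Par} {st : Stage} (h : Good P st) (X : Bool) :
    ∃ (U : Type) (_ : Inhabited U) (v : Val U), st.Mod X U v := by
  by_contra hc
  push Not at hc
  apply h.2
  cases X with
  | true => exact sep_of_unsatL (fun U _ v hv => hc U inferInstance v hv)
  | false => exact sep_of_unsatR (fun U _ v hv => hc U inferInstance v hv)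

/-! ### Extension steps -/

theorem sat_cons_upd {U : Type} {T : NTy} {Γ : List NTy} (ψ : D0 (T :: Γ)) (e : SEnv Γ) (x : Nm)
    (hfr : e.All (fun k => k ≠ (x, T))) (v : Val U) (o : NObj U T) :
    Form.Sat ⟨T :: Γ, ψ, SEnv.cons (reflect T (.var x)) e⟩ (upd v T x o) ↔
      ψ.Sat (Env.cons o (ienv (sev v) e)) := by
  show ψ.Sat (ienv _ _) ↔ _
  rw [ienv_push v x o hfr]

theorem mem_sat_upd {U : Type} {T : NTy} (τ : Neu (.set T)) (x : Nm) (hfr : τ.key ≠ (x, T))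
    (X : Bool) (v : Val U) (o : NObj U T) (ho : Ok X τ.key.1.1 → o ∈ NObj.asSet (τ.ev v)) :
    Mem.Sat X ⟨T, τ, x⟩ (upd v T x o) := by
  intro hok
  show upd v T x o T x ∈ NObj.asSet (τ.ev (upd v T x o))
  rw [upd_self, ev_upd v T x o τ hfr]
  exact ho hok

theorem ex_sat {U : Type} {T : NTy} {Γ : List NTy} (t : Tm Γ (.set T)) (ψ : D0 (T :: Γ))
    (e : SEnv Γ) (v : Val U) (h : Form.Sat ⟨Γ, .ex t ψ, e⟩ v) :
    ∃ o ∈ NObj.asSet (Neu.ev v (T := .set T) (t.seval e)),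
      ψ.Sat (Env.cons o (ienv (sev v) e)) := by
  obtain ⟨o, ho, hs⟩ := h
  refine ⟨o, ?_, hs⟩
  have := Tm.eval_sev v t e
  exact (congrArg (fun s => o ∈ NObj.asSet s) this).mp ho

theorem Good.exStep {P : Par} {st : Stage} (h : Good P st) (X : Bool) {T : NTy} {Γ : List NTy}
    (t : Tm Γ (.set T)) (ψ : D0 (T :: Γ)) (e : SEnv Γ)
    (hf : (⟨Γ, .ex t ψ, e⟩ : Form) ∈ st.Th X) :
    ∃ st', Good P st' ∧ st.Le st' ∧ ∃ x : Nm, (⟨T, t.seval e, x⟩ : Mem) ∈ st'.M ∧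
      (⟨T :: Γ, ψ, SEnv.cons (reflect T (.var x)) e⟩ : Form) ∈ st'.Th X := by
  have hall := h.1.forms X _ hf
  obtain ⟨τ, hτ⟩ : ∃ τ : Neu (.set T), τ = t.seval e := ⟨_, rfl⟩
  have hτk : KOk X st.K τ.key := by rw [hτ]; exact Tm.all_seval t e hall
  have hex : ∀ (U : Type) [Inhabited U] (v : Val U), st.Mod X U v →
      ∃ o ∈ NObj.asSet (τ.ev v), ψ.Sat (Env.cons o (ienv (sev v) e)) := by
    intro U _ v hv
    rw [hτ]
    exact ex_sat t ψ e v (hv.1 _ hf)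
  by_cases hc : τ.key.1.1 = .c
  · obtain ⟨n, hn⟩ := h.1.exists_fresh .c T
    obtain ⟨x, hx⟩ : ∃ x : Nm, x = (Col.c, n) := ⟨_, rfl⟩
    rw [← hx] at hn
    have hx1 : ∀ Y, Ok Y x.1 := by intro Y; rw [hx]; trivial
    have hτx : τ.key ≠ (x, T) := fun he => hn (he ▸ hτk.2)
    have hfr : e.All (fun k => k ≠ (x, T)) := hall.fresh hn (fun k hk => hk.2)
    obtain ⟨t', ht', hte⟩ := h.1.exists_tm τ hτk.2 hc
    have hev : ∀ (U : Type) (v : Val U), t'.eval (ienv (sev v) st.e) = τ.ev v := by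
      intro U v
      rw [Tm.eval_sev, hte, sev_reflect]
    have hKx : (x, T) ∈ (st.push T x).K := Or.inl rfl
    refine ⟨(st.push T x).ext ∅ (fun Y => {g | Y = X ∧ g = ⟨T :: Γ, ψ,
      SEnv.cons (reflect T (.var x)) e⟩}) {⟨T, τ, x⟩}, ⟨?_, ?_⟩, ?_, x, ?_, ?_⟩
    · refine (h.1.push T x).ext Set.finite_empty (by simp) ?_ ?_
      · rintro Y g ⟨rfl, rfl⟩
        refine SEnv.all_cons (SV.all_reflect _ _ ⟨hx1 _, Or.inl hKx⟩) ?_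
        exact hall.mono (KOk.mono (fun k hk => Or.inl (Or.inr hk)))
      · rintro m rfl
        exact ⟨Or.inl (Or.inr hτk.2), Or.inl hKx, fun Y _ => hx1 Y⟩
    · intro hs
      apply h.2
      have hmod : ∀ (Y : Bool) (U : Type) [Inhabited U] (v : Val U) (o : NObj U T), st.Mod Y U v →
          o ∈ NObj.asSet (τ.ev v) → (Y = X → ψ.Sat (Env.cons o (ienv (sev v) e))) →
          ((st.push T x).ext ∅ (fun Y => {g | Y = X ∧ g = ⟨T :: Γ, ψ,
            SEnv.cons (reflect T (.var x)) e⟩}) {⟨T, τ, x⟩}).Mod Y U (upd v T x o) := by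
        intro Y U _ v o hv ho hp
        rw [Stage.mod_ext]
        refine ⟨h.1.mod_upd hn Y v o hv, ?_, ?_⟩
        · rintro g ⟨hY, rfl⟩
          exact (sat_cons_upd ψ e x hfr v o).mpr (hp hY)
        · rintro m rfl
          exact mem_sat_upd τ x hτx Y v o (fun _ => ho)
      cases X with
      | true =>
        refine sep_exL t' ht' x (h.1.env.fresh hn (fun k hk => hk))
          (fun U v o => h.1.lam_upd hn v o) hs ?_ ?_
        · intro U _ v hv
          obtain ⟨o, ho, hp⟩ := hex U v hv
          rw [hev]
          exact ⟨o, ho, hmod true U v o hv ho (fun _ => hp)⟩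
        · intro U _ v hv o ho
          rw [hev] at ho
          exact hmod false U v o hv ho (fun h => by cases h)
      | false =>
        refine sep_exR t' ht' x (h.1.env.fresh hn (fun k hk => hk))
          (fun U v o => h.1.lam_upd hn v o) hs ?_ ?_
        · intro U _ v hv o ho
          rw [hev] at ho
          exact hmod true U v o hv ho (fun h => by cases h)
        · intro U _ v hv
          obtain ⟨o, ho, hp⟩ := hex U v hv
          rw [hev]
          exact ⟨o, ho, hmod false U v o hv ho (fun _ => hp)⟩
    · exact (st.le_push T x).trans (Stage.le_ext _ _ _ _)
    · rw [← hτ]; exact Or.inr rfl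
    · exact Or.inr ⟨rfl, rfl⟩
  · obtain ⟨n, hn⟩ := h.1.exists_fresh (priv X) T
    obtain ⟨x, hx⟩ : ∃ x : Nm, x = (priv X, n) := ⟨_, rfl⟩
    rw [← hx] at hn
    have hx1 : Ok X x.1 := by rw [hx]; exact ok_priv X
    have hτx : τ.key ≠ (x, T) := fun he => hn (he ▸ hτk.2)
    have hfr : e.All (fun k => k ≠ (x, T)) := hall.fresh hn (fun k hk => hk.2)
    have hcol : ∀ Y, Ok Y τ.key.1.1 → Y = X := not_ok_of_ne hc hτk.1
    refine ⟨st.ext {(x, T)} (fun Y => {g | Y = X ∧ g = ⟨T :: Γ, ψ,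
      SEnv.cons (reflect T (.var x)) e⟩}) {⟨T, τ, x⟩}, ⟨?_, ?_⟩, Stage.le_ext _ _ _ _, x, ?_, ?_⟩
    · refine h.1.ext (Set.finite_singleton _) ?_ ?_ ?_
      · rintro k rfl
        rw [hx]; exact priv_ne X
      · rintro Y g ⟨rfl, rfl⟩
        refine SEnv.all_cons (SV.all_reflect _ _ ⟨hx1, Or.inr rfl⟩) ?_
        exact hall.mono (KOk.mono (fun k hk => Or.inl hk))
      · rintro m rfl
        refine ⟨Or.inl hτk.2, Or.inr rfl, fun Y hY => ?_⟩
        rw [hcol Y hY]; exact hx1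
    · intro hs
      apply h.2
      have key : ∀ (Y : Bool) (U : Type) [Inhabited U] (v : Val U), st.Mod Y U v →
          ∃ v', (st.ext {(x, T)} (fun Y => {g | Y = X ∧ g = ⟨T :: Γ, ψ,
            SEnv.cons (reflect T (.var x)) e⟩}) {⟨T, τ, x⟩}).Mod Y U v' ∧
            ienv (sev v') st.e = ienv (sev v) st.e ∧ P.Lam U v' = P.Lam U v := by
        intro Y U _ v hv
        by_cases hY : Y = X
        · subst hY
          obtain ⟨o, ho, hp⟩ := hex U v hv
          refine ⟨upd v T x o, ?_, ienv_upd v T x o _ (h.1.env.fresh hn (fun k hk => hk)),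
            h.1.lam_upd hn v o⟩
          rw [Stage.mod_ext]
          refine ⟨h.1.mod_upd hn Y v o hv, ?_, ?_⟩
          · rintro g ⟨_, rfl⟩
            exact (sat_cons_upd ψ e x hfr v o).mpr hp
          · rintro m rfl
            exact mem_sat_upd τ x hτx Y v o (fun _ => ho)
        · refine ⟨v, ?_, rfl, rfl⟩
          rw [Stage.mod_ext]
          refine ⟨hv, ?_, ?_⟩
          · rintro g ⟨h', _⟩; exact (hY h').elim
          · rintro m rfl hok
            exact (hY (hcol Y hok)).elim
      exact sep_mono hs (key true) (key false)
    · rw [← hτ]; exact Or.inr rfl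
    · exact Or.inr ⟨rfl, rfl⟩

def Par.lamF (P : Par) (b : Bool) (x : Nm) : Form :=
  ⟨P.Tz :: P.Γ, if b then P.lam else P.lam.neg, SEnv.cons (reflect P.Tz (.var x)) P.eL⟩

def Par.rhoF (P : Par) (b : Bool) (x : Nm) (w : SV P.Ty) : Form :=
  ⟨P.Tz :: P.Ty :: P.Γ, if b then P.rho else P.rho.neg,
    SEnv.cons (reflect P.Tz (.var x)) (SEnv.cons w P.eR)⟩

def Par.goalG (P : Par) (b : Bool) (x : Nm) (w : SV P.Ty) (Y : Bool) : Set Form :=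
  {g | (Y = true ∧ g = P.lamF b x) ∨ (Y = false ∧ g = P.rhoF (!b) x w)}

theorem Good.goalStep {P : Par} {st : Stage} (h : Good P st) (w : SV P.Ty)
    (hw : SV.All (KOk false st.K) P.Ty w) :
    ∃ st', Good P st' ∧ st.Le st' ∧ ∃ (x : Nm) (b : Bool), (⟨P.Tz, P.cN, x⟩ : Mem) ∈ st'.M ∧
      P.lamF b x ∈ st'.Th true ∧ P.rhoF (!b) x w ∈ st'.Th false := by
  obtain ⟨n, hn⟩ := h.1.exists_fresh .c P.Tz
  obtain ⟨x, hx⟩ : ∃ x : Nm, x = (Col.c, n) := ⟨_, rfl⟩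
  rw [← hx] at hn
  have hx1 : ∀ Y, Ok Y x.1 := by intro Y; rw [hx]; trivial
  have hτx : P.cN.key ≠ (x, P.Tz) := fun he => hn (he ▸ h.1.cok)
  obtain ⟨t', ht', hte⟩ := h.1.exists_tm P.cN h.1.cok rfl
  have hev : ∀ (U : Type) (v : Val U), t'.eval (ienv (sev v) st.e) = P.cN.ev v := by
    intro U v
    rw [Tm.eval_sev, hte, sev_reflect]
  have hKx : (x, P.Tz) ∈ (st.push P.Tz x).K := Or.inl rfl
  have hwf : ∀ b, WF P ((st.push P.Tz x).ext ∅ (P.goalG b x w) {⟨P.Tz, P.cN, x⟩}) := by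
    intro b
    refine (h.1.push P.Tz x).ext Set.finite_empty (by simp) ?_ ?_
    · rintro Y g (⟨rfl, rfl⟩ | ⟨rfl, rfl⟩)
      · refine SEnv.all_cons (SV.all_reflect _ _ ⟨hx1 _, Or.inl hKx⟩) ?_
        exact h.1.eLok.mono (KOk.mono (fun k hk => Or.inl (Or.inr hk)))
      · refine SEnv.all_cons (SV.all_reflect _ _ ⟨hx1 _, Or.inl hKx⟩) (SEnv.all_cons ?_ ?_)
        · exact SV.All.mono (KOk.mono (fun k hk => Or.inl (Or.inr hk))) _ _ hw
        · exact h.1.eRok.mono (KOk.mono (fun k hk => Or.inl (Or.inr hk)))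
    · rintro m rfl
      exact ⟨Or.inl (Or.inr h.1.cok), Or.inl hKx, fun Y _ => hx1 Y⟩
  suffices hs : ∃ b, ¬ ((st.push P.Tz x).ext ∅ (P.goalG b x w) {⟨P.Tz, P.cN, x⟩}).Sepd P by
    obtain ⟨b, hb⟩ := hs
    exact ⟨_, ⟨hwf b, hb⟩, (st.le_push P.Tz x).trans (Stage.le_ext _ _ _ _), x, b, Or.inr rfl,
      Or.inr (Or.inl ⟨rfl, rfl⟩), Or.inr (Or.inr ⟨rfl, rfl⟩)⟩
  by_contra hcon
  push Not at hcon
  have hfrL : P.eL.All (fun k => k ≠ (x, P.Tz)) := h.1.eLok.fresh hn (fun k hk => hk.2)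
  have hfrR : (SEnv.cons w P.eR).All (fun k => k ≠ (x, P.Tz)) :=
    SEnv.All.fresh hn (fun k hk => hk.2) (SEnv.all_cons hw h.1.eRok)
  have hmod : ∀ (b Y : Bool) (U : Type) [Inhabited U] (v : Val U) (o : NObj U P.Tz),
      st.Mod Y U v → o ∈ NObj.asSet (P.cN.ev v) →
      (Y = true → (b = true ↔ P.lam.Sat (Env.cons o (ienv (sev v) P.eL)))) →
      (Y = false → ((!b) = true ↔
        P.rho.Sat (Env.cons o (ienv (sev v) (SEnv.cons w P.eR))))) →
      ((st.push P.Tz x).ext ∅ (P.goalG b x w) {⟨P.Tz, P.cN, x⟩}).Mod Y U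
        (upd v P.Tz x o) := by
    intro b Y U _ v o hv ho h1 h2
    rw [Stage.mod_ext]
    refine ⟨h.1.mod_upd hn Y v o hv, ?_, ?_⟩
    · rintro g (⟨hY, rfl⟩ | ⟨hY, rfl⟩)
      · refine (sat_cons_upd _ _ x hfrL v o).mpr ?_
        have := h1 hY
        cases b
        · simpa [D0.sat_neg] using this
        · simpa using this
      · refine (sat_cons_upd _ _ x hfrR v o).mpr ?_
        have := h2 hY
        cases b
        · simpa using this
        · simpa [D0.sat_neg] using this
    · rintro m rfl
      exact mem_sat_upd P.cN x hτx Y v o (fun _ => ho)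
  apply h.2
  refine sep_goal t' ht' x (h.1.env.fresh hn (fun k hk => hk))
    (fun U v o => h.1.lam_upd hn v o) ?_ (hcon true) (hcon false) ?_ ?_ ?_
  · intro U v o ho
    rw [hev]; exact ho.1
  · intro U _ v hv o ho hl
    rw [hev] at ho
    exact hmod true true U v o hv ho (fun _ => by simpa using hl.2) (fun h => by cases h)
  · intro U _ v hv o ho hl
    rw [hev] at ho
    refine hmod false true U v o hv ho (fun _ => ?_) (fun h => by cases h)
    have : ¬ P.lam.Sat (Env.cons o (ienv (sev v) P.eL)) := fun hh => hl ⟨ho, hh⟩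
    simpa using this
  · intro U _ v hv o ho
    rw [hev] at ho
    by_cases hr : P.rho.Sat (Env.cons o (ienv (sev v) (SEnv.cons w P.eR)))
    · right
      exact hmod false false U v o hv ho (fun h => by cases h) (fun _ => by simpa using hr)
    · left
      exact hmod true false U v o hv ho (fun h => by cases h) (fun _ => by simpa using hr)

/-! ### Deciding equalities -/

def SEnv.nil : SEnv [] := fun i => i.elim0

def pairEnv (s t : Neu .ur) : SEnv [.ur, .ur] :=
  SEnv.cons (T := .ur) s (SEnv.cons (T := .ur) t SEnv.nil)

def eqF (s t : Neu .ur) : Form :=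
  ⟨[.ur, .ur], .eq (Tm.zero .ur [.ur]) (Tm.weak .ur (Tm.zero .ur [])), pairEnv s t⟩

def neF (s t : Neu .ur) : Form :=
  ⟨[.ur, .ur], .ne (Tm.zero .ur [.ur]) (Tm.weak .ur (Tm.zero .ur [])), pairEnv s t⟩

theorem pairEnv_fst (s t : Neu .ur) : (Tm.zero .ur [.ur]).seval (pairEnv s t) = s :=
  Tm.zero_seval _ _ _ _

theorem pairEnv_snd (s t : Neu .ur) :
    (Tm.weak .ur (Tm.zero .ur [])).seval (pairEnv s t) = t :=
  (Tm.weak_seval NTy.ur (Tm.zero .ur []) s _).trans (Tm.zero_seval _ _ _ _)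

theorem eqF_sat {U : Type} (s t : Neu .ur) (v : Val U) :
    Form.Sat (eqF s t) v ↔ s.ev v = t.ev v := by
  show Tm.eval _ (ienv _ _) = Tm.eval _ (ienv _ _) ↔ _
  simp only [eqF]
  rw [Tm.eval_sev, Tm.eval_sev, pairEnv_fst, pairEnv_snd]
  rfl

theorem neF_sat {U : Type} (s t : Neu .ur) (v : Val U) :
    Form.Sat (neF s t) v ↔ s.ev v ≠ t.ev v := by
  show Tm.eval _ (ienv _ _) ≠ Tm.eval _ (ienv _ _) ↔ _
  simp only [neF]
  rw [Tm.eval_sev, Tm.eval_sev, pairEnv_fst, pairEnv_snd]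
  rfl

theorem pairEnv_all {Q : Key → Prop} {s t : Neu .ur} (hs : Q s.key) (ht : Q t.key) :
    (pairEnv s t).All Q :=
  SEnv.all_cons (T := .ur) hs (SEnv.all_cons (T := .ur) ht (fun i => i.elim0))

theorem pairEnv_all_iff {Q : Key → Prop} {s t : Neu .ur} (h : (pairEnv s t).All Q) :
    Q s.key ∧ Q t.key :=
  ⟨h (0 : Fin 2), h (1 : Fin 2)⟩

theorem Good.decStep {P : Par} {st : Stage} (h : Good P st) (X : Bool) (s t : Neu .ur)
    (hs : KOk X st.K s.key) (ht : KOk X st.K t.key) :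
    ∃ st', Good P st' ∧ st.Le st' ∧ (eqF s t ∈ st'.Th X ∨ neF s t ∈ st'.Th X) := by
  rcases h.split X (eqF s t) (neF s t) (pairEnv_all hs ht) (pairEnv_all hs ht) (by
    intro U _ v _
    rw [eqF_sat, neF_sat]
    exact Classical.em _) with h' | h'
  · exact ⟨_, h', Stage.le_ext _ _ _ _, Or.inl (Stage.mem_addF _ _ _)⟩
  · exact ⟨_, h', Stage.le_ext _ _ _ _, Or.inr (Stage.mem_addF _ _ _)⟩

theorem Good.decCStep {P : Par} {st : Stage} (h : Good P st) (s t : Neu .ur)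
    (hs : s.key ∈ st.K) (ht : t.key ∈ st.K) (hsc : s.key.1.1 = .c) (htc : t.key.1.1 = .c) :
    ∃ st', Good P st' ∧ st.Le st' ∧ ((∀ X, eqF s t ∈ st'.Th X) ∨ (∀ X, neF s t ∈ st'.Th X)) := by
  obtain ⟨a, ha, hae⟩ := h.1.exists_tm s hs hsc
  obtain ⟨b, hb, hbe⟩ := h.1.exists_tm t ht htc
  have hs' : ∀ X, KOk X st.K s.key := fun X => ⟨by rw [hsc]; trivial, hs⟩
  have ht' : ∀ X, KOk X st.K t.key := fun X => ⟨by rw [htc]; trivial, ht⟩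
  have hσ : ∀ (U : Type) (v : Val U), (D0.eq a b).Sat (ienv (sev v) st.e) ↔ s.ev v = t.ev v := by
    intro U v
    show a.eval _ = b.eval _ ↔ _
    rw [Tm.eval_sev, Tm.eval_sev, hae, hbe, sev_reflect, sev_reflect]
  have hwf : ∀ f : Form, f = eqF s t ∨ f = neF s t → WF P (st.ext ∅ (fun _ => {f}) ∅) := by
    intro f hf
    refine h.1.ext Set.finite_empty (by simp) ?_ (by simp)
    rintro X g rfl
    rcases hf with rfl | rfl
    · exact (pairEnv_all (hs' X) (ht' X)).mono (KOk.mono Set.subset_union_left)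
    · exact (pairEnv_all (hs' X) (ht' X)).mono (KOk.mono Set.subset_union_left)
  by_cases h1 : (st.ext ∅ (fun _ => {eqF s t}) ∅).Sepd P
  · by_cases h2 : (st.ext ∅ (fun _ => {neF s t}) ∅).Sepd P
    · exfalso
      apply h.2
      have hmod : ∀ (f : Form) (X : Bool) (U : Type) [Inhabited U] (v : Val U), st.Mod X U v →
          Form.Sat f v → (st.ext ∅ (fun _ => {f}) ∅).Mod X U v := by
        intro f X U _ v hv hf
        rw [Stage.mod_ext]
        refine ⟨hv, ?_, fun m hm => hm.elim⟩
        rintro g rfl; exact hf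
      refine sep_cut (D0.eq a b) ?_ h1 h2 ?_ ?_ ?_ ?_
      · simp only [D0.fv]; exact Finset.union_subset ha hb
      all_goals
        intro U _ v hv hh
        rw [hσ] at hh
        refine hmod _ _ U v hv ?_
        first
          | exact (eqF_sat s t v).mpr hh
          | exact (neF_sat s t v).mpr hh
    · exact ⟨_, ⟨hwf _ (Or.inr rfl), h2⟩, Stage.le_ext _ _ _ _, Or.inr (fun X => Or.inr rfl)⟩
  · exact ⟨_, ⟨hwf _ (Or.inl rfl), h1⟩, Stage.le_ext _ _ _ _, Or.inl (fun X => Or.inr rfl)⟩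

/-! ### Tasks and the limit stage -/

abbrev Job (P : Par) :=
  (Bool × Form × Nm) ⊕ ((Bool × Neu .ur × Neu .ur) ⊕ ((Neu .ur × Neu .ur) ⊕ SV P.Ty))

def FPre : ∀ {Γ}, D0 Γ → SEnv Γ → Nm → Stage → Prop
  | _, .all (T := T) t _, e, x, st => (⟨T, t.seval e, x⟩ : Mem) ∈ st.M
  | _, _, _, _, _ => True

def FPost (X : Bool) : ∀ {Γ}, D0 Γ → SEnv Γ → Nm → Stage → Prop
  | Γ, .and φ ψ, e, _, st => (⟨Γ, φ, e⟩ : Form) ∈ st.Th X ∧ (⟨Γ, ψ, e⟩ : Form) ∈ st.Th X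
  | Γ, .or φ ψ, e, _, st => (⟨Γ, φ, e⟩ : Form) ∈ st.Th X ∨ (⟨Γ, ψ, e⟩ : Form) ∈ st.Th X
  | Γ, .all (T := T) _ ψ, e, x, st =>
    (⟨T :: Γ, ψ, SEnv.cons (reflect T (.var x)) e⟩ : Form) ∈ st.Th X
  | Γ, .ex (T := T) t ψ, e, _, st => ∃ x : Nm, (⟨T, t.seval e, x⟩ : Mem) ∈ st.M ∧
    (⟨T :: Γ, ψ, SEnv.cons (reflect T (.var x)) e⟩ : Form) ∈ st.Th X
  | _, _, _, _, _ => True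

def Pre {P : Par} : Job P → Stage → Prop
  | .inl (X, f, x), st => f ∈ st.Th X ∧ FPre f.2.1 f.2.2 x st
  | .inr (.inl (X, s, t)), st => KOk X st.K s.key ∧ KOk X st.K t.key
  | .inr (.inr (.inl (s, t))), st =>
    (s.key ∈ st.K ∧ t.key ∈ st.K) ∧ s.key.1.1 = .c ∧ t.key.1.1 = .c
  | .inr (.inr (.inr w)), st => SV.All (KOk false st.K) P.Ty w

def Post {P : Par} : Job P → Stage → Prop
  | .inl (X, f, x), st => FPost X f.2.1 f.2.2 x st
  | .inr (.inl (X, s, t)), st => eqF s t ∈ st.Th X ∨ neF s t ∈ st.Th X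
  | .inr (.inr (.inl (s, t))), st =>
    (∀ X, eqF s t ∈ st.Th X) ∨ (∀ X, neF s t ∈ st.Th X)
  | .inr (.inr (.inr w)), st => ∃ (x : Nm) (b : Bool), (⟨P.Tz, P.cN, x⟩ : Mem) ∈ st.M ∧
      P.lamF b x ∈ st.Th true ∧ P.rhoF (!b) x w ∈ st.Th false

theorem FPre.mono {Γ : List NTy} (φ : D0 Γ) (e : SEnv Γ) (x : Nm) {a b : Stage} (h : a.Le b)
    (hp : FPre φ e x a) : FPre φ e x b := by
  cases φ <;> first | exact h.2.2 hp | trivial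

theorem FPost.mono (X : Bool) {Γ : List NTy} (φ : D0 Γ) (e : SEnv Γ) (x : Nm) {a b : Stage}
    (h : a.Le b) (hp : FPost X φ e x a) : FPost X φ e x b := by
  cases φ with
  | and φ ψ => exact ⟨h.2.1 X hp.1, h.2.1 X hp.2⟩
  | or φ ψ => exact Or.imp (fun k => h.2.1 X k) (fun k => h.2.1 X k) hp
  | all t ψ => exact h.2.1 X hp
  | ex t ψ =>
    obtain ⟨y, h1, h2⟩ := hp
    exact ⟨y, h.2.2 h1, h.2.1 X h2⟩
  | _ => trivial

theorem Pre.mono {P : Par} (τ : Job P) {a b : Stage} (h : a.Le b) (hp : Pre τ a) : Pre τ b := by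
  rcases τ with ⟨X, f, x⟩ | ⟨X, s, t⟩ | ⟨s, t⟩ | w
  · exact ⟨h.2.1 X hp.1, FPre.mono _ _ _ h hp.2⟩
  · exact ⟨KOk.mono h.1 _ hp.1, KOk.mono h.1 _ hp.2⟩
  · exact ⟨⟨h.1 hp.1.1, h.1 hp.1.2⟩, hp.2⟩
  · exact SV.All.mono (KOk.mono h.1) _ _ hp

theorem Post.mono {P : Par} (τ : Job P) {a b : Stage} (h : a.Le b) (hp : Post τ a) :
    Post τ b := by
  rcases τ with ⟨X, f, x⟩ | ⟨X, s, t⟩ | ⟨s, t⟩ | w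
  · exact FPost.mono X _ _ _ h hp
  · exact Or.imp (fun k => h.2.1 X k) (fun k => h.2.1 X k) hp
  · exact Or.imp (fun k X => h.2.1 X (k X)) (fun k X => h.2.1 X (k X)) hp
  · obtain ⟨x, b', h1, h2, h3⟩ := hp
    exact ⟨x, b', h.2.2 h1, h.2.1 _ h2, h.2.1 _ h3⟩

theorem Good.allStep {P : Par} {st : Stage} (h : Good P st) (X : Bool) {T : NTy} {Γ : List NTy}
    (t : Tm Γ (.set T)) (ψ : D0 (T :: Γ)) (e : SEnv Γ)
    (hf : (⟨Γ, .all t ψ, e⟩ : Form) ∈ st.Th X) (x : Nm)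
    (hm : (⟨T, t.seval e, x⟩ : Mem) ∈ st.M) :
    Good P (st.addF X ⟨T :: Γ, ψ, SEnv.cons (reflect T (.var x)) e⟩) := by
  have hall := h.1.forms X _ hf
  have hτk : KOk X st.K (Neu.key (T := .set T) (t.seval e)) := Tm.all_seval t e hall
  obtain ⟨_, h2, h3⟩ := h.1.mems _ hm
  refine h.add X _ (SEnv.all_cons (SV.all_reflect _ _ ⟨h3 X hτk.1, h2⟩) hall) ?_
  intro U _ v hv
  show ψ.Sat (ienv _ _)
  rw [ienv_cons, sev_reflect]
  have h4 := hv.1 _ hf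
  have h5 : Mem.Sat X _ v := hv.2 _ hm
  refine h4 _ ?_
  have := Tm.eval_sev v t e
  exact (congrArg (fun s => v T x ∈ NObj.asSet s) this).mpr (h5 hτk.1)

theorem Good.step {P : Par} {st : Stage} (h : Good P st) (τ : Job P) :
    ∃ st', Good P st' ∧ st.Le st' ∧ (Pre τ st → Post τ st') := by
  by_cases hp : Pre τ st
  swap
  · exact ⟨st, h, .refl st, fun h => (hp h).elim⟩
  suffices hs : ∃ st', Good P st' ∧ st.Le st' ∧ Post τ st' by
    obtain ⟨s, h1, h2, h3⟩ := hs
    exact ⟨s, h1, h2, fun _ => h3⟩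
  rcases τ with ⟨X, ⟨Γ, φ, e⟩, x⟩ | ⟨X, s, t⟩ | ⟨s, t⟩ | w
  · obtain ⟨hf, hq⟩ := hp
    have hall := h.1.forms X _ hf
    cases φ with
    | and φ ψ =>
      have g1 := h.add X ⟨Γ, φ, e⟩ hall (fun U _ v hv => (hv.1 _ hf).1)
      have g2 := g1.add X ⟨Γ, ψ, e⟩ (hall.mono (KOk.mono (Stage.le_ext _ _ _ _).1))
        (fun U _ v hv => (hv.1 _ (Or.inl hf)).2)
      exact ⟨_, g2, (Stage.le_ext _ _ _ _).trans (Stage.le_ext _ _ _ _),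
        Or.inl (Stage.mem_addF _ _ _), Stage.mem_addF _ _ _⟩
    | or φ ψ =>
      rcases h.split X ⟨Γ, φ, e⟩ ⟨Γ, ψ, e⟩ hall hall (fun U _ v hv => hv.1 _ hf) with g | g
      · exact ⟨_, g, Stage.le_ext _ _ _ _, Or.inl (Stage.mem_addF _ _ _)⟩
      · exact ⟨_, g, Stage.le_ext _ _ _ _, Or.inr (Stage.mem_addF _ _ _)⟩
    | all t ψ =>
      exact ⟨_, h.allStep X t ψ e hf x hq, Stage.le_ext _ _ _ _, Stage.mem_addF _ _ _⟩
    | ex t ψ =>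
      obtain ⟨s, h1, h2, h3⟩ := h.exStep X t ψ e hf
      exact ⟨s, h1, h2, h3⟩
    | _ => exact ⟨st, h, .refl st, trivial⟩
  · exact h.decStep X s t hp.1 hp.2
  · exact h.decCStep s t hp.1.1 hp.1.2 hp.2.1 hp.2.2
  · exact h.goalStep w hp

structure Hinti (P : Par) (S : Stage) : Prop where
  post : ∀ τ : Job P, Pre τ S → Post τ S
  sat : ∀ X (l : List Form), (∀ f ∈ l, f ∈ S.Th X) →
    ∃ (U : Type) (v : Val U), ∀ f ∈ l, Form.Sat f v
  forms : ∀ X, ∀ f ∈ S.Th X, f.2.2.All (KOk X S.K)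
  mems : ∀ m ∈ S.M, m.2.1.key ∈ S.K ∧ (m.2.2, m.1) ∈ S.K ∧
    ∀ X, Ok X m.2.1.key.1.1 → Ok X m.2.2.1

theorem Good.chain {P : Par} {st : Stage} (h : Good P st) :
    ∃ q : ℕ → Stage, q 0 = st ∧ (∀ n, Good P (q n)) ∧ (∀ n, (q n).Le (q (n + 1))) ∧
      ∀ (τ : Job P) (N : ℕ), Pre τ (q N) → ∃ n, Post τ (q n) := by
  have hne : Nonempty (Job P) := ⟨.inr (.inr (.inl (.var (.c, 0), .var (.c, 0))))⟩
  obtain ⟨f, hf⟩ := exists_surjective_nat (Job P)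
  have hstep : ∀ (s : {s : Stage // Good P s}) (τ : Job P), ∃ s' : {s : Stage // Good P s},
      s.1.Le s'.1 ∧ (Pre τ s.1 → Post τ s'.1) := by
    intro s τ
    obtain ⟨s', h1, h2, h3⟩ := s.2.step τ
    exact ⟨⟨s', h1⟩, h2, h3⟩
  choose nx hnx using hstep
  obtain ⟨q, hq⟩ : ∃ q : ℕ → {s : Stage // Good P s},
      q = fun n => Nat.rec ⟨st, h⟩ (fun n s => nx s (f (Nat.unpair n).1)) n := ⟨_, rfl⟩
  have hq0 : q 0 = ⟨st, h⟩ := by rw [hq]; rfl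
  have hqs : ∀ n, q (n + 1) = nx (q n) (f (Nat.unpair n).1) := by intro n; rw [hq]
  have hle : ∀ n, (q n).1.Le (q (n + 1)).1 := by
    intro n; rw [hqs]; exact (hnx _ _).1
  have hmono : ∀ n m, n ≤ m → (q n).1.Le (q m).1 := by
    intro n m hnm
    induction hnm with
    | refl => exact .refl _
    | step _ ih => exact ih.trans (hle _)
  refine ⟨fun n => (q n).1, congrArg Subtype.val hq0, fun n => (q n).2, hle, ?_⟩
  intro τ N hp
  obtain ⟨k, rfl⟩ := hf τ
  refine ⟨Nat.pair k N + 1, ?_⟩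
  have h1 := Pre.mono _ (hmono N (Nat.pair k N) (Nat.right_le_pair k N)) hp
  have h2 := (hnx (q (Nat.pair k N)) (f k)).2 h1
  show Post _ (q _).1
  rw [hqs]
  simpa using h2

theorem Good.limit {P : Par} {st : Stage} (h : Good P st) :
    ∃ S : Stage, st.Le S ∧ Hinti P S := by
  obtain ⟨q, hq0, hg, hle, hpost⟩ := h.chain
  have hmono : ∀ n m, n ≤ m → (q n).Le (q m) := by
    intro n m hnm
    induction hnm with
    | refl => exact .refl _
    | step _ ih => exact ih.trans (hle _)
  obtain ⟨S, hS⟩ : ∃ S : Stage, S = { st with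
      K := ⋃ n, (q n).K, Th := fun X => ⋃ n, (q n).Th X, M := ⋃ n, (q n).M } := ⟨_, rfl⟩
  have hK : ∀ k, k ∈ S.K ↔ ∃ n, k ∈ (q n).K := by intro k; rw [hS]; simp
  have hT : ∀ X k, k ∈ S.Th X ↔ ∃ n, k ∈ (q n).Th X := by intro X k; rw [hS]; simp
  have hM : ∀ k, k ∈ S.M ↔ ∃ n, k ∈ (q n).M := by intro k; rw [hS]; simp
  have hqS : ∀ n, (q n).Le S := fun n =>
    ⟨fun k hk => (hK k).mpr ⟨n, hk⟩, fun X k hk => (hT X k).mpr ⟨n, hk⟩,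
      fun k hk => (hM k).mpr ⟨n, hk⟩⟩
  refine ⟨S, hq0 ▸ hqS 0, ?_, ?_, ?_, ?_⟩
  · intro τ hp
    suffices hs : ∃ N, Pre τ (q N) by
      obtain ⟨N, hN⟩ := hs
      obtain ⟨n, hn⟩ := hpost τ N hN
      exact Post.mono τ (hqS n) hn
    have two : ∀ k k', k ∈ S.K → k' ∈ S.K → ∃ n, k ∈ (q n).K ∧ k' ∈ (q n).K := by
      intro k k' hk hk'
      obtain ⟨n, hn⟩ := (hK k).mp hk
      obtain ⟨m, hm⟩ := (hK k').mp hk'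
      exact ⟨max n m, (hmono _ _ (le_max_left n m)).1 hn, (hmono _ _ (le_max_right n m)).1 hm⟩
    rcases τ with ⟨X, ⟨Γ, φ, e⟩, x⟩ | ⟨X, s, t⟩ | ⟨s, t⟩ | w
    · obtain ⟨hf, hx⟩ := hp
      obtain ⟨n, hn⟩ := (hT _ _).mp hf
      have : ∃ m, FPre φ e x (q m) := by
        cases φ with
        | all t ψ => exact (hM _).mp hx
        | _ => exact ⟨0, trivial⟩
      obtain ⟨m, hm⟩ := this
      exact ⟨max n m, (hmono _ _ (le_max_left n m)).2.1 X hn,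
        FPre.mono _ _ _ (hmono _ _ (le_max_right n m)) hm⟩
    · obtain ⟨n, h1, h2⟩ := two _ _ hp.1.2 hp.2.2
      exact ⟨n, ⟨hp.1.1, h1⟩, hp.2.1, h2⟩
    · obtain ⟨n, h1, h2⟩ := two _ _ hp.1.1 hp.1.2
      exact ⟨n, ⟨h1, h2⟩, hp.2⟩
    · have : ∀ (T : NTy) (w : SV T), SV.All (KOk false S.K) T w →
          ∃ n, SV.All (KOk false (q n).K) T w := by
        intro T
        induction T with
        | ur =>
          intro w hw
          obtain ⟨n, hn⟩ := (hK _).mp hw.2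
          exact ⟨n, hw.1, hn⟩
        | unit => intro w _; exact ⟨0, trivial⟩
        | prod a b iha ihb =>
          intro w hw
          obtain ⟨n, hn⟩ := iha _ hw.1
          obtain ⟨m, hm⟩ := ihb _ hw.2
          exact ⟨max n m, SV.All.mono (KOk.mono (hmono _ _ (le_max_left n m)).1) _ _ hn,
            SV.All.mono (KOk.mono (hmono _ _ (le_max_right n m)).1) _ _ hm⟩
        | set a _ =>
          intro w hw
          obtain ⟨n, hn⟩ := (hK _).mp hw.2
          exact ⟨n, hw.1, hn⟩
      exact this _ w hp
  · intro X l hl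
    have : ∃ n, ∀ f ∈ l, f ∈ (q n).Th X := by
      induction l with
      | nil => exact ⟨0, by simp⟩
      | cons a l ih =>
        obtain ⟨n, hn⟩ := ih (fun f hf => hl f (List.mem_cons_of_mem _ hf))
        obtain ⟨m, hm⟩ := (hT _ _).mp (hl a List.mem_cons_self)
        refine ⟨max n m, ?_⟩
        intro f hf
        rcases List.mem_cons.mp hf with rfl | hf
        · exact (hmono _ _ (le_max_right n m)).2.1 X hm
        · exact (hmono _ _ (le_max_left n m)).2.1 X (hn f hf)
    obtain ⟨n, hn⟩ := this
    obtain ⟨U, _, v, hv⟩ := (hg n).sat X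
    exact ⟨U, v, fun f hf => hv.1 f (hn f hf)⟩
  · intro X f hf
    obtain ⟨n, hn⟩ := (hT _ _).mp hf
    exact ((hg n).1.forms X f hn).mono (KOk.mono (hqS n).1)
  · intro m hm
    obtain ⟨n, hn⟩ := (hM _).mp hm
    obtain ⟨h1, h2, h3⟩ := (hg n).1.mems m hn
    exact ⟨(hqS n).1 h1, (hqS n).1 h2, h3⟩

/-! ### The model of the limit stage -/

def Stage.E (S : Stage) (X : Bool) (s t : Neu .ur) : Prop := eqF s t ∈ S.Th X

abbrev Stage.Un (S : Stage) : Type := Quot (fun s t : Neu .ur => ∃ X, S.E X s t)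

def interp (S : Stage) : ∀ T, SV T → NObj S.Un T
  | .ur, n => Quot.mk _ n
  | .unit, _ => ()
  | .prod a b, s => (interp S a s.1, interp S b s.2)
  | .set a, n => {o | ∃ x : Nm, (⟨a, n, x⟩ : Mem) ∈ S.M ∧ o = interp S a (reflect a (.var x))}

section Model
variable {P : Par} {S : Stage}

theorem Hinti.known (h : Hinti P S) {X : Bool} {s t : Neu .ur} (hE : S.E X s t) :
    KOk X S.K s.key ∧ KOk X S.K t.key :=
  pairEnv_all_iff (h.forms X _ hE)

theorem Hinti.intro (h : Hinti P S) {X : Bool} {s t : Neu .ur} (hs : KOk X S.K s.key)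
    (ht : KOk X S.K t.key) (l : List Form) (hl : ∀ f ∈ l, f ∈ S.Th X)
    (hv : ∀ (U : Type) (v : Val U), (∀ f ∈ l, Form.Sat f v) → s.ev v = t.ev v) : S.E X s t := by
  rcases h.post (.inr (.inl (X, s, t))) ⟨hs, ht⟩ with h1 | h1
  · exact h1
  · exfalso
    obtain ⟨U, v, hs⟩ := h.sat X (neF s t :: l) (by
      intro f hf
      rcases List.mem_cons.mp hf with rfl | hf
      · exact h1
      · exact hl f hf)
    have h2 := (neF_sat s t v).mp (hs _ List.mem_cons_self)
    exact h2 (hv U v (fun f hf => hs f (List.mem_cons_of_mem _ hf)))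

theorem Hinti.symm (h : Hinti P S) {X : Bool} {s t : Neu .ur} (hE : S.E X s t) : S.E X t s := by
  refine h.intro (h.known hE).2 (h.known hE).1 [eqF s t] (by intro f hf; rw [List.mem_singleton.mp hf]; exact hE) ?_
  intro U v hv
  exact ((eqF_sat s t v).mp (hv _ (by simp))).symm

theorem Hinti.refl (h : Hinti P S) {X : Bool} {s : Neu .ur} (hs : KOk X S.K s.key) : S.E X s s :=
  h.intro hs hs [] (by simp) (fun _ _ _ => rfl)

theorem Hinti.trans (h : Hinti P S) {X : Bool} {s t u : Neu .ur} (h1 : S.E X s t)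
    (h2 : S.E X t u) : S.E X s u := by
  refine h.intro (h.known h1).1 (h.known h2).2 [eqF s t, eqF t u] (by
    intro f hf
    simp only [List.mem_cons, List.not_mem_nil, or_false] at hf
    rcases hf with rfl | rfl
    · exact h1
    · exact h2) ?_
  intro U v hv
  exact ((eqF_sat s t v).mp (hv _ (by simp))).trans ((eqF_sat t u v).mp (hv _ (by simp)))

theorem Hinti.common (h : Hinti P S) {X Y : Bool} {s t : Neu .ur} (hE : S.E Y s t)
    (hs : KOk X S.K s.key) (ht : KOk X S.K t.key) : S.E X s t := by
  by_cases hXY : X = Y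
  · rw [hXY]; exact hE
  have hc : ∀ n : Neu .ur, KOk X S.K n.key → KOk Y S.K n.key → n.key.1.1 = .c := by
    intro n h1 h2
    cases X <;> cases Y
    · exact (hXY rfl).elim
    · exact eq_c_of_ok h2.1 h1.1
    · exact eq_c_of_ok h1.1 h2.1
    · exact (hXY rfl).elim
  have hk := h.known hE
  rcases h.post (.inr (.inr (.inl (s, t)))) ⟨⟨hs.2, ht.2⟩, hc s hs hk.1, hc t ht hk.2⟩ with h1 | h1
  · exact h1 X
  · exfalso
    obtain ⟨U, v, hs⟩ := h.sat Y [eqF s t, neF s t] (by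
      intro f hf
      simp only [List.mem_cons, List.not_mem_nil, or_false] at hf
      rcases hf with rfl | rfl
      · exact hE
      · exact h1 Y)
    exact (neF_sat s t v).mp (hs _ (by simp)) ((eqF_sat s t v).mp (hs _ (by simp)))

def Stage.F (S : Stage) (X : Bool) (s u : Neu .ur) : Prop :=
  S.E X s u ∨ ∃ m, S.E X s m ∧ S.E (!X) m u

theorem Hinti.F_step (h : Hinti P S) {X Y : Bool} {s u u' : Neu .ur} (hF : S.F X s u)
    (hE : S.E Y u u') : S.F X s u' := by
  by_cases hY : Y = X
  · subst hY
    left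
    rcases hF with h1 | ⟨m, h1, h2⟩
    · exact h.trans h1 hE
    · have h3 := h.common h2 (h.known h1).2 (h.known hE).1
      exact h.trans (h.trans h1 h3) hE
  · have hY' : Y = !X := by cases X <;> cases Y <;> simp_all
    subst hY'
    right
    rcases hF with h1 | ⟨m, h1, h2⟩
    · exact ⟨u, h1, hE⟩
    · exact ⟨m, h1, h.trans h2 hE⟩

theorem Hinti.of_mk_eq (h : Hinti P S) {X : Bool} {s t : Neu .ur} (hs : KOk X S.K s.key)
    (ht : KOk X S.K t.key)
    (he : (Quot.mk _ s : S.Un) = Quot.mk _ t) : S.E X s t := by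
  let G : S.Un → Prop := Quot.lift (S.F X s) (by
    rintro a b ⟨Y, hY⟩
    exact propext ⟨fun hF => h.F_step hF hY, fun hF => h.F_step hF (h.symm hY)⟩)
  have h1 : G (Quot.mk _ s) := Or.inl (h.refl hs)
  rw [he] at h1
  rcases h1 with h1 | ⟨m, h1, h2⟩
  · exact h1
  · exact h.trans h1 (h.common h2 (h.known h1).2 ht)

theorem Hinti.truth (h : Hinti P S) (X : Bool) {Γ : List NTy} (φ : D0 Γ) :
    ∀ e : SEnv Γ, (⟨Γ, φ, e⟩ : Form) ∈ S.Th X → φ.Sat (ienv (interp S) e) := by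
  have hI : ∀ {Γ : List NTy} {T : NTy} (t : Tm Γ T) (e : SEnv Γ),
      t.eval (ienv (interp S) e) = interp S T (t.seval e) :=
    fun t e => Tm.eval_ienv (interp S) (fun _ _ _ => rfl) t e
  induction φ with
  | eq a b =>
    intro e hf
    have hall := h.forms X _ hf
    show a.eval _ = b.eval _
    rw [hI, hI]
    refine Quot.sound ⟨X, ?_⟩
    refine h.intro (Tm.all_seval a e hall) (Tm.all_seval b e hall) [_] (by simpa using hf) ?_
    intro U v hv
    have h1 : a.eval (ienv (sev v) e) = b.eval (ienv (sev v) e) := hv _ List.mem_cons_self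
    rw [Tm.eval_sev, Tm.eval_sev] at h1
    exact h1
  | ne a b =>
    intro e hf
    have hall := h.forms X _ hf
    show a.eval _ ≠ b.eval _
    rw [hI, hI]
    intro he
    have hE := h.of_mk_eq (X := X) (Tm.all_seval a e hall) (Tm.all_seval b e hall) he
    obtain ⟨U, v, hs⟩ := h.sat X [eqF (a.seval e) (b.seval e), _] (by
      intro f hf'
      simp only [List.mem_cons, List.not_mem_nil, or_false] at hf'
      rcases hf' with rfl | rfl
      · exact hE
      · exact hf)
    have h1 := (eqF_sat _ _ v).mp (hs _ List.mem_cons_self)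
    have h2 : a.eval (ienv (sev v) e) ≠ b.eval (ienv (sev v) e) :=
      hs _ (List.mem_cons_of_mem _ List.mem_cons_self)
    rw [Tm.eval_sev, Tm.eval_sev] at h2
    exact h2 h1
  | tru => intro e _; trivial
  | fls =>
    intro e hf
    obtain ⟨U, v, hs⟩ := h.sat X [_] (by simpa using hf)
    exact hs _ List.mem_cons_self
  | and φ ψ ih₁ ih₂ =>
    intro e hf
    have := h.post (.inl (X, ⟨_, .and φ ψ, e⟩, (.c, 0))) ⟨hf, trivial⟩
    exact ⟨ih₁ e this.1, ih₂ e this.2⟩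
  | or φ ψ ih₁ ih₂ =>
    intro e hf
    have := h.post (.inl (X, ⟨_, .or φ ψ, e⟩, (.c, 0))) ⟨hf, trivial⟩
    exact Or.imp (ih₁ e) (ih₂ e) this
  | all t ψ ih =>
    intro e hf o ho
    rw [hI] at ho
    obtain ⟨x, hx, rfl⟩ := ho
    have := h.post (.inl (X, ⟨_, .all t ψ, e⟩, x)) ⟨hf, hx⟩
    have := ih _ this
    rwa [ienv_cons] at this
  | ex t ψ ih =>
    intro e hf
    obtain ⟨x, hx, hp⟩ := h.post (.inl (X, ⟨_, .ex t ψ, e⟩, (.c, 0))) ⟨hf, trivial⟩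
    have := ih _ hp
    rw [ienv_cons] at this
    refine ⟨_, ?_, this⟩
    rw [hI]
    exact ⟨x, hx, rfl⟩

theorem Hinti.mem_elim (h : Hinti P S) {X : Bool} {T : NTy} {n : SV (.set T)}
    (hn : SV.All (KOk X S.K) (.set T) n) {o : NObj S.Un T}
    (ho : o ∈ NObj.asSet (interp S (.set T) n)) :
    ∃ w : SV T, SV.All (KOk X S.K) T w ∧ o = interp S T w := by
  obtain ⟨x, hx, rfl⟩ := ho
  obtain ⟨_, h2, h3⟩ := h.mems _ hx
  exact ⟨_, SV.all_reflect T (.var x) ⟨h3 X hn.1, h2⟩, rfl⟩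

theorem Hinti.reach (h : Hinti P S) {X : Bool} {T T' : NTy} (p : SubPath T T') :
    ∀ (n : SV T), SV.All (KOk X S.K) T n → ∀ o : NObj S.Un T', o ∈ Reach p (interp S T n) →
    ∃ w : SV T', SV.All (KOk X S.K) T' w ∧ o = interp S T' w := by
  induction p with
  | refl => intro n hn o ho; exact ⟨n, hn, ho⟩
  | mem p ih =>
    intro n hn o ho
    obtain ⟨y, hy, hp⟩ := ho
    obtain ⟨w, hw, rfl⟩ := h.mem_elim hn hy
    exact ih w hw o hp
  | left p ih => intro n hn o ho; exact ih n.1 hn.1 o ho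
  | right p ih => intro n hn o ho; exact ih n.2 hn.2 o ho

theorem Hinti.goal (h : Hinti P S) {w : SV P.Ty} (hw : SV.All (KOk false S.K) P.Ty w) :
    ∃ z ∈ NObj.asSet (interp S (.set P.Tz) P.cN),
      ¬ (P.lam.Sat (Env.cons z (ienv (interp S) P.eL)) ↔
        P.rho.Sat (Env.cons z (Env.cons (interp S P.Ty w) (ienv (interp S) P.eR)))) := by
  obtain ⟨x, b, hx, h1, h2⟩ := h.post (.inr (.inr (.inr w))) hw
  have k1 := h.truth true _ _ h1
  have k2 := h.truth false _ _ h2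
  rw [ienv_cons] at k1 k2
  rw [ienv_cons] at k2
  refine ⟨_, ⟨x, hx, rfl⟩, ?_⟩
  cases b
  · simp only [Bool.not_false, Bool.false_eq_true, if_true, if_false, D0.sat_neg] at k1 k2
    intro hh; exact k1 (hh.mpr k2)
  · simp only [Bool.not_true, Bool.false_eq_true, if_true, if_false, D0.sat_neg] at k1 k2
    intro hh; exact k2 (hh.mp k1)

end Model

/-! ### The initial stage and the main theorem -/

section Init
variable {Γ : List NTy} (L R : Finset (Fin Γ.length))

noncomputable def colI (k : Col) (i : Fin Γ.length) : Col := if i ∈ L ∩ R then .c else k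

noncomputable def keyI (k : Col) (i : Fin Γ.length) : Key := ((colI L R k i, i.val), Γ.get i)

noncomputable def envI (k : Col) : SEnv Γ := fun i => reflect _ (.var (colI L R k i, i.val))

theorem envI_all {Q : Key → Prop} (k : Col) (h : ∀ i, Q (keyI L R k i)) : (envI L R k).All Q :=
  fun i => SV.all_reflect _ _ (h i)

theorem ok_colI {X : Bool} {k : Col} (hk : Ok X k) (i : Fin Γ.length) : Ok X (colI L R k i) := by
  unfold colI
  split_ifs
  · trivial
  · exact hk

theorem mem_of_colI {k : Col} (hk : k ≠ .c) {i : Fin Γ.length} (h : colI L R k i = .c) :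
    i ∈ L ∩ R := by
  unfold colI at h
  split_ifs at h with hi
  · exact hi
  · exact (hk h).elim

noncomputable def initPar (Tz Ty : NTy) (c : Fin Γ.length) (lam : D0 (Tz :: Γ))
    (rho : D0 (Tz :: Ty :: Γ)) : Par where
  Γ := Γ
  Tz := Tz
  Ty := Ty
  cx := c.val
  eL := envI L R .l
  eR := envI L R .r
  lam := lam
  rho := rho

noncomputable def initStage (φL φR : D0 Γ) : Stage where
  Δ := Γ
  e := envI L R .l
  A := L ∩ R
  K := Set.range (keyI L R .l) ∪ Set.range (keyI L R .r)
  Th := fun X => {f | (X = true ∧ f = ⟨Γ, φL, envI L R .l⟩) ∨ (X = false ∧ f = ⟨Γ, φR, envI L R .r⟩)}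
  M := ∅

theorem init_wf (Tz Ty : NTy) (c : Fin Γ.length) (hc : c ∈ L ∩ R) (hcT : Γ.get c = NTy.set Tz)
    (lam : D0 (Tz :: Γ)) (rho : D0 (Tz :: Ty :: Γ)) (φL φR : D0 Γ) :
    WF (initPar L R Tz Ty c lam rho) (initStage L R φL φR) where
  fin := (Set.finite_range _).union (Set.finite_range _)
  forms := by
    rintro X f (⟨rfl, rfl⟩ | ⟨rfl, rfl⟩)
    · exact envI_all L R _ (fun i => ⟨ok_colI L R (X := true) (k := .l) rfl i, Or.inl ⟨i, rfl⟩⟩)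
    · exact envI_all L R _ (fun i => ⟨ok_colI L R (X := false) (k := .r) rfl i, Or.inr ⟨i, rfl⟩⟩)
  mems := by intro m hm; exact hm.elim
  env := envI_all L R _ (fun i => Or.inl ⟨i, rfl⟩)
  terms := by
    have key : ∀ (k : Col) (hk : k ≠ .c) (i : Fin Γ.length), colI L R k i = .c →
        ∃ t : Tm Γ (Γ.get i), t.fv ⊆ L ∩ R ∧
          t.seval (envI L R .l) = reflect _ (.var (colI L R k i, i.val)) := by
      intro k hk i hi
      have hm := mem_of_colI L R hk hi
      refine ⟨.var i, ?_, ?_⟩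
      · simpa [Tm.fv] using hm
      · rw [Tm.seval, hi]
        unfold envI colI
        rw [if_pos hm]
    rintro T x (⟨i, hi⟩ | ⟨i, hi⟩) hx
    · cases hi
      exact key .l (by simp) i hx
    · cases hi
      exact key .r (by simp) i hx
  eLok := envI_all L R _ (fun i => ⟨ok_colI L R (X := true) (k := .l) rfl i, Or.inl ⟨i, rfl⟩⟩)
  eRok := envI_all L R _ (fun i => ⟨ok_colI L R (X := false) (k := .r) rfl i, Or.inr ⟨i, rfl⟩⟩)
  cok := by
    refine Or.inl ⟨c, ?_⟩
    show keyI L R .l c = ((Col.c, c.val), NTy.set Tz)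
    rw [keyI, hcT, colI, if_pos hc]

noncomputable def valOf {U : Type} [Inhabited U] (ρ : Env U Γ) : Val U := fun T x =>
  if h : ∃ hi : x.2 < Γ.length, Γ.get ⟨x.2, hi⟩ = T then castObj h.2 (ρ ⟨x.2, h.1⟩)
  else NObj.defaultObj U T

theorem valOf_eq {U : Type} [Inhabited U] (ρ : Env U Γ) (i : Fin Γ.length) (k : Col) (T : NTy)
    (h : Γ.get i = T) : valOf ρ T (k, i.val) = castObj h (ρ i) := by
  have : ∃ hi : ((k, i.val) : Nm).2 < Γ.length, Γ.get ⟨((k, i.val) : Nm).2, hi⟩ = T := ⟨i.2, h⟩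
  unfold valOf
  rw [dif_pos this]

theorem ienv_valOf {U : Type} [Inhabited U] (ρ : Env U Γ) (k : Col) :
    ienv (sev (valOf ρ)) (envI L R k) = ρ := by
  funext i
  show sev _ _ (reflect _ _) = _
  rw [sev_reflect]
  exact valOf_eq ρ i _ _ rfl

theorem castObj_interp (S : Stage) (x : Nm) {T T' : NTy} (h : T = .set T') :
    castObj h (interp S T (reflect T (.var x))) = interp S (.set T') (Neu.var x) := by
  subst h; rfl

end Init


/-- **NRC Parameter Collection** (Theorem 4.3): let `L`, `R` be sets of variables with
`C = L ∩ R`, let `φL` and `λ(z)` be Δ₀ formulas over `L`, let `φR` and `ρ(z,y)` be Δ₀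
formulas over `R`, let `r` be a variable of `R` and `c` a set-typed variable of `C`.
If `φL ∧ φR` entails `∃ y ∈_p r ∀ z ∈ c (λ(z) ↔ ρ(z,y))`, then there is a (get-free) `NRC`
expression `E` with free variables in `C` such that `φL ∧ φR` entails
`{z ∈ c : λ(z)} ∈ E`. -/
theorem nrc_parameter_collection
    {Γ : List NTy} (L R : Finset (Fin Γ.length))
    (Tz Ty : NTy)
    (c r : Fin Γ.length) (hc : c ∈ L ∩ R) (hr : r ∈ R)
    (hcT : Γ.get c = NTy.set Tz)
    (p : SubPath (Γ.get r) (NTy.set Ty))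
    (φL : D0 Γ) (hφL : φL.fv ⊆ L)
    (lam : D0 (Tz :: Γ)) (hlam : lam.fv ⊆ insert (0 : Fin (Γ.length + 1)) (L.image Fin.succ))
    (φR : D0 Γ) (hφR : φR.fv ⊆ R)
    (rho : D0 (Tz :: Ty :: Γ))
    (hrho : rho.fv ⊆ insert (0 : Fin (Γ.length + 2)) (insert (1 : Fin (Γ.length + 2)) ((R.image Fin.succ).image Fin.succ)))
    (h : ∀ (U : Type) (ρ : Env U Γ), φL.Sat ρ → φR.Sat ρ →
      ∃ s ∈ Reach p (ρ r), ∃ y ∈ NObj.asSet s,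
        ∀ z ∈ NObj.asSet (castObj hcT (ρ c)),
          (lam.Sat (Env.cons z ρ) ↔ rho.Sat (Env.cons z (Env.cons y ρ)))) :
    ∃ E : NRC Γ (NTy.set (NTy.set Tz)),
      E.NoGet ∧ E.fv ⊆ L ∩ R ∧
      ∀ (U : Type) [Inhabited U] (ρ : Env U Γ), φL.Sat ρ → φR.Sat ρ →
        { z ∈ NObj.asSet (castObj hcT (ρ c)) | lam.Sat (Env.cons z ρ) }
          ∈ NObj.asSet (E.eval ρ) := by
  have hwf := init_wf L R Tz Ty c hc hcT lam rho φL φR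
  by_cases hsep : (initStage L R φL φR).Sepd (initPar L R Tz Ty c lam rho)
  · obtain ⟨θ, E, _, hE, hN, hl, hr'⟩ := hsep
    refine ⟨E, hN, hE, ?_⟩
    intro U _ ρ h1 h2
    have m1 : (initStage L R φL φR).Mod true U (valOf ρ) := by
      refine ⟨?_, fun m hm => hm.elim⟩
      rintro f (⟨_, rfl⟩ | ⟨hX, _⟩)
      · show φL.Sat _
        rw [ienv_valOf]; exact h1
      · cases hX
    have m2 : (initStage L R φL φR).Mod false U (valOf ρ) := by
      refine ⟨?_, fun m hm => hm.elim⟩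
      rintro f (⟨hX, _⟩ | ⟨_, rfl⟩)
      · cases hX
      · show φR.Sat _
        rw [ienv_valOf]; exact h2
    have k := (hl U _ m1).resolve_left (hr' U _ m2)
    have e1 : ienv (sev (valOf ρ)) (initStage L R φL φR).e = ρ := ienv_valOf L R ρ .l
    have e2 : (initPar L R Tz Ty c lam rho).Lam U (valOf ρ) =
        { z ∈ NObj.asSet (castObj hcT (ρ c)) | lam.Sat (Env.cons z ρ) } := by
      have e3 : (initPar L R Tz Ty c lam rho).cN.ev (valOf ρ) = castObj hcT (ρ c) :=
        valOf_eq ρ c .c _ hcT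
      have e4 : ienv (sev (valOf ρ)) (initPar L R Tz Ty c lam rho).eL = ρ := ienv_valOf L R ρ .l
      unfold Par.Lam
      rw [e3, e4]
      rfl
    rw [e1, e2] at k
    exact k
  · exfalso
    obtain ⟨S, hle, hS⟩ := Good.limit (P := initPar L R Tz Ty c lam rho) ⟨hwf, hsep⟩
    obtain ⟨ρ, hρ⟩ : ∃ ρ : Env S.Un Γ, ρ = fun i => if i ∈ L then interp S _ (envI L R .l i)
      else interp S _ (envI L R .r i) := ⟨_, rfl⟩
    have hρL : ∀ i ∈ L, ienv (interp S) (envI L R .l) i = ρ i := by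
      intro i hi
      rw [hρ]
      simp only [hi, if_true]
      rfl
    have hρR : ∀ i ∈ R, ienv (interp S) (envI L R .r) i = ρ i := by
      intro i hi
      by_cases hiL : i ∈ L
      · rw [← hρL i hiL]
        have hm : i ∈ L ∩ R := Finset.mem_inter.mpr ⟨hiL, hi⟩
        unfold ienv envI colI
        rw [if_pos hm, if_pos hm]
      · rw [hρ]
        simp only [hiL, if_false]
        rfl
    have s1 : φL.Sat ρ := (φL.sat_congr _ _ (fun i hi => hρL i (hφL hi))).mp
      (hS.truth true φL _ (hle.2.1 true (Or.inl ⟨rfl, rfl⟩)))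
    have s2 : φR.Sat ρ := (φR.sat_congr _ _ (fun i hi => hρR i (hφR hi))).mp
      (hS.truth false φR _ (hle.2.1 false (Or.inr ⟨rfl, rfl⟩)))
    obtain ⟨s, hs, y, hy, hz⟩ := h S.Un ρ s1 s2
    rw [← hρR r hr] at hs
    have hall : (envI L R .r).All (KOk false S.K) :=
      SEnv.All.mono (KOk.mono hle.1) hwf.eRok
    obtain ⟨w, hw, rfl⟩ := hS.reach p _ (hall r) s hs
    obtain ⟨w', hw', rfl⟩ := hS.mem_elim hw hy
    obtain ⟨z, hzc, hzn⟩ := hS.goal (P := initPar L R Tz Ty c lam rho) hw'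
    apply hzn
    have hcast : castObj hcT (ρ c) = interp S (.set Tz) (Neu.var (Col.c, c.val)) := by
      rw [← hρL c (Finset.mem_inter.mp hc).1]
      have : ienv (interp S) (envI L R .l) c =
          interp S _ (reflect _ (.var (Col.c, c.val))) := by
        unfold ienv envI colI
        rw [if_pos hc]
      rw [this]
      exact castObj_interp S _ hcT
    have h3 := hz z (by rw [hcast]; exact hzc)
    have h4 : lam.Sat (Env.cons z (ienv (interp S) (envI L R .l))) ↔ lam.Sat (Env.cons z ρ) := by
      refine lam.sat_congr _ _ (Env.cons_congr lam.fv z _ _ (fun i hi => hρL i ?_))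
      exact lowerFv_liftA (A := L) hlam hi
    have h5 : rho.Sat (Env.cons z (Env.cons (interp S Ty w') (ienv (interp S) (envI L R .r)))) ↔
        rho.Sat (Env.cons z (Env.cons (interp S Ty w') ρ)) := by
      refine rho.sat_congr _ _ (Env.cons_congr rho.fv z _ _ (Env.cons_congr _ _ _ _
        (fun i hi => hρR i ?_)))
      refine lowerFv_liftA (A := R) ?_ hi
      refine lowerFv_liftA (A := liftA R) ?_
      refine hrho.trans ?_
      intro j hj
      simp only [liftA, Finset.mem_insert, Finset.image_insert, Fin.succ_zero_eq_one] at hj ⊢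
      exact hj
    exact h4.trans (h3.trans h5.symm)
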